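/- arXiv:1601.03870 — 2 statements merged into one kernel-verified Lean document; each statement's English description precedes it below -/
import Mathlib

section
/- Let n ≥ 2, let I = [a, b] ⊂ ℝ be a compact interval, and let g : I → ℝ be continuous, positive on (a, b), and continuously differentiable on (a, b) with bounded derivative (extended by 0 outside I). Let q > 2n/(n−1). Then there is a constant C (depending only on n, q and g) such that for every sequence of real indices {ν_j}_{j≥1} with ν_j ≥ (n−2)/2 for all j, and every sequence of Schwartz functions a_j : ℝ → ℂ (all but finitely many identically zero), ∫_0^∞ ρ^{−q(n−2)/2 + n − 1} ( Σ_j ∫_ℝ |g(z)|ⁿ (1 + g′(z)²) |a_j(z)|² |J_{ν_j}(ρ g(z))|² dz )^{q/2} dρ ≤ C · ( Σ_j ∫_ℝ |g(z)|^{n−1} (1 + g′(z)²)^{1/2} |a_j(z)|² dz )^{q/2}. -/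
open Real

/-- The Bessel function of the first kind of real order `ν`, defined for `x ≥ 0` by the
convergent power series `J_ν(x) = ∑_{m=0}^∞ (-1)^m / (m! Γ(m+ν+1)) (x/2)^{2m+ν}`
(with real exponents interpreted via `Real.rpow`, so that `J_ν(0) = 0` for `ν > 0` and
`J_0(0) = 1`). -/
noncomputable def besselJ (ν x : ℝ) : ℝ :=
  ∑' m : ℕ, ((-1 : ℝ) ^ m / (m.factorial * Real.Gamma (m + ν + 1))) * (x / 2) ^ (2 * (m : ℝ) + ν)

open MeasureTheory


lemma bsl_gamma_ge {x : ℝ} (hx : 1 ≤ x) : (1/2 : ℝ) ≤ Real.Gamma x := by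
  have key : ∀ y : ℝ, 2 ≤ y → 1 ≤ Real.Gamma y := by
    intro y hy
    have := Real.Gamma_strictMonoOn_Ici.monotoneOn (Set.mem_Ici.2 le_rfl) (Set.mem_Ici.2 hy) hy
    rwa [Real.Gamma_two] at this
  rcases le_total 2 x with h | h
  · linarith [key x h]
  · have h1 := key (x+1) (by linarith)
    rw [Real.Gamma_add_one (by linarith)] at h1
    have h2 : 0 < Real.Gamma x := Real.Gamma_pos_of_pos (by linarith)
    nlinarith

noncomputable def bslC (ν : ℝ) (m : ℕ) : ℝ := (-1 : ℝ) ^ m / (m.factorial * Real.Gamma (m + ν + 1))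

noncomputable def bslP (ν y : ℝ) : ℝ := ∑' m : ℕ, bslC ν m * y ^ m

lemma bslC_abs {ν : ℝ} (hν : 0 ≤ ν) (m : ℕ) : |bslC ν m| ≤ 2 / m.factorial := by
  have hG : (1/2 : ℝ) ≤ Real.Gamma (m + ν + 1) := by
    have : (0:ℝ) ≤ m := m.cast_nonneg
    exact bsl_gamma_ge (by linarith)
  have hf : (0 : ℝ) < m.factorial := by positivity
  unfold bslC
  rw [abs_div, abs_pow, abs_neg, abs_one, one_pow, abs_of_pos (by positivity)]
  rw [div_le_div_iff₀ (by positivity) hf]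
  nlinarith

lemma bslP_term {ν : ℝ} (hν : 0 ≤ ν) (y : ℝ) (m : ℕ) :
    ‖bslC ν m * y ^ m‖ ≤ 2 * (|y| ^ m / m.factorial) := by
  rw [Real.norm_eq_abs, abs_mul, abs_pow]
  calc _ ≤ 2 / (m.factorial : ℝ) * |y| ^ m := by gcongr; exact bslC_abs hν m
    _ = _ := by ring

lemma bslP_summable {ν : ℝ} (hν : 0 ≤ ν) (y : ℝ) : Summable fun m => bslC ν m * y ^ m :=
  Summable.of_norm_bounded ((Real.summable_pow_div_factorial |y|).mul_left 2) (bslP_term hν y)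

lemma bslP_abs {ν : ℝ} (hν : 0 ≤ ν) (y : ℝ) : |bslP ν y| ≤ 2 * Real.exp |y| := by
  have h := tsum_of_norm_bounded
    (((Real.summable_pow_div_factorial |y|).hasSum).mul_left 2) (bslP_term hν y)
  rw [Real.exp_eq_exp_ℝ, NormedSpace.exp_eq_tsum_div]
  exact h

lemma bslC_succ {ν : ℝ} (m : ℕ) : bslC ν (m+1) * ((m : ℝ) + 1) = - bslC (ν+1) m := by
  unfold bslC
  have hf : (m.factorial : ℝ) ≠ 0 := by positivity
  have hm : (m : ℝ) + 1 ≠ 0 := by positivity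
  have e : ((m + 1 : ℕ) : ℝ) + ν + 1 = m + (ν + 1) + 1 := by push_cast; ring
  rw [e, Nat.factorial_succ]
  push_cast
  by_cases hG : Real.Gamma (m + (ν + 1) + 1) = 0
  · simp [hG]
  field_simp
  ring

lemma bslP_hasDeriv {ν : ℝ} (hν : 0 ≤ ν) (y : ℝ) : HasDerivAt (bslP ν) (- bslP (ν+1) y) y := by
  set R := |y| + 1
  have hsum : Summable fun m : ℕ => 2 * (R ^ (m-1) / ((m-1).factorial : ℝ)) := by
    rw [← summable_nat_add_iff 1]
    simpa using (Real.summable_pow_div_factorial R).mul_left 2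
  have key := hasDerivAt_tsum_of_isPreconnected (t := Metric.ball 0 R)
    (g := fun (m : ℕ) (y : ℝ) => bslC ν m * y ^ m)
    (g' := fun (m : ℕ) (y : ℝ) => bslC ν m * (m * y ^ (m-1))) (y₀ := 0) (y := y) hsum
    Metric.isOpen_ball (convex_ball (0:ℝ) R).isPreconnected
    (fun m z _ => (hasDerivAt_pow m z).const_mul _) ?_ (by simp [R]; positivity)
    (bslP_summable hν 0) (by simp [R])
  · have h2 : ∑' m : ℕ, bslC ν m * (m * y ^ (m-1)) = - bslP (ν+1) y := by
      rw [Summable.tsum_eq_zero_add]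
      · simp only [bslP, CharP.cast_eq_zero, zero_mul, mul_zero, zero_add, ← tsum_neg]
        congr 1; ext m
        have := bslC_succ (ν := ν) m
        push_cast
        try simp only [Nat.add_sub_cancel]
        linear_combination y ^ m * this
      · rw [← summable_nat_add_iff 1]
        have := (bslP_summable (ν := ν+1) (by linarith) y).neg
        refine this.congr fun m => ?_
        have := bslC_succ (ν := ν) m
        push_cast
        try simp only [Nat.add_sub_cancel]
        linear_combination -y ^ m * this
    rw [h2] at key
    exact key
  · intro m z hz
    have hz' : |z| ≤ R := by simpa using (Metric.mem_ball.1 hz).le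
    rcases m with _ | m
    · simp
    · have := bslC_succ (ν := ν) m
      have e : bslC ν (m+1) * (((m+1 : ℕ) : ℝ) * z ^ (m+1-1)) = -(bslC (ν+1) m * z ^ m) := by
        push_cast
        try simp only [Nat.add_sub_cancel]
        linear_combination z ^ m * this
      rw [e, norm_neg]
      refine (bslP_term (by linarith) z m).trans ?_
      simp only [Nat.add_sub_cancel]
      gcongr

lemma bslP_rec {ν : ℝ} (hν : 0 ≤ ν) (y : ℝ) :
    bslP ν y = (ν+1) * bslP (ν+1) y - y * bslP (ν+2) y := by
  have h1 := bslP_summable (ν := ν+1) (by linarith) y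
  have h2 := bslP_summable (ν := ν+2) (by linarith) y
  have h0 := bslP_summable hν y
  have e : ∀ m : ℕ, bslC ν m = (ν + 1 + m) * bslC (ν+1) m := by
    intro m
    unfold bslC
    have hm : (0:ℝ) ≤ m := m.cast_nonneg
    have e : (m : ℝ) + (ν + 1) + 1 = (m + ν + 1) + 1 := by ring
    have h1 : (m : ℝ) + ν + 1 ≠ 0 := by positivity
    rw [e, Real.Gamma_add_one h1]
    have : Real.Gamma (m + ν + 1) ≠ 0 := (Real.Gamma_pos_of_pos (by positivity)).ne'
    have : (m : ℝ) + ν + 1 ≠ 0 := by positivity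
    generalize Real.Gamma (m + ν + 1) = Γ at *
    field_simp
    ring
  have h3 : ∀ m : ℕ, bslC (ν+1) (m+1) * ((m : ℝ) + 1) = - bslC (ν+2) m := by
    intro m
    have := bslC_succ (ν := ν+1) m
    rw [this]; ring_nf
  have t : ∑' m : ℕ, (m : ℝ) * bslC (ν+1) m * y ^ m = - (y * bslP (ν+2) y) := by
    have hs : ∀ m : ℕ, ((m+1 : ℕ) : ℝ) * bslC (ν+1) (m+1) * y ^ (m+1)
        = -(y * (bslC (ν+2) m * y ^ m)) := by
      intro m; push_cast; linear_combination y^(m+1) * h3 m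
    rw [Summable.tsum_eq_zero_add]
    · simp only [hs, tsum_neg, tsum_mul_left, bslP]; simp
    · rw [← summable_nat_add_iff 1]
      simp only [hs]
      exact (h2.mul_left y).neg
  have hs1 : Summable fun m : ℕ => (m : ℝ) * bslC (ν+1) m * y ^ m := by
    refine (h0.sub (h1.mul_left (ν+1))).congr fun m => ?_
    rw [e]; ring
  have : bslP ν y = ∑' m : ℕ, ((ν+1) * (bslC (ν+1) m * y ^ m) + (m : ℝ) * bslC (ν+1) m * y ^ m) := by
    unfold bslP; congr 1; ext m; rw [e]; ring
  rw [this, (h1.mul_left (ν+1)).tsum_add hs1, tsum_mul_left, t]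
  unfold bslP; ring

lemma besselJ_eq {ν x : ℝ} (hx : 0 < x) : besselJ ν x = (x/2)^ν * bslP ν (x^2/4) := by
  unfold besselJ bslP
  rw [← tsum_mul_left]
  congr 1; ext m
  have : (x/2) ^ (2 * (m:ℝ) + ν) = (x^2/4)^m * (x/2)^ν := by
    rw [Real.rpow_add (by positivity), Real.rpow_mul (by positivity), Real.rpow_natCast]
    congr 2
    norm_num; ring
  rw [this]; unfold bslC; ring

lemma besselJ_crude {ν x : ℝ} (hν : 0 ≤ ν) (hx : 0 < x) :
    |besselJ ν x| ≤ 2 * Real.exp (x^2/4) * (x/2)^ν := by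
  rw [besselJ_eq hx, abs_mul, abs_of_nonneg (Real.rpow_nonneg (by positivity) _)]
  have := bslP_abs hν (x^2/4)
  rw [abs_of_nonneg (by positivity : 0 ≤ x^2/4)] at this
  have h2 : 0 ≤ (x/2)^ν := Real.rpow_nonneg (by positivity) _
  nlinarith

lemma besselJ_rec {ν x : ℝ} (hν : 0 ≤ ν) (hx : 0 < x) :
    besselJ (ν+2) x = 2 * (ν+1) / x * besselJ (ν+1) x - besselJ ν x := by
  rw [besselJ_eq hx, besselJ_eq hx, besselJ_eq hx, bslP_rec hν]
  have h1 : (x/2)^(ν+1) = (x/2)^ν * (x/2) := Real.rpow_add_one (by positivity) _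
  have h2 : (x/2)^(ν+2) = (x/2)^ν * (x/2)^2 := by
    rw [Real.rpow_add (by positivity)]; norm_num
  rw [h1, h2]
  field_simp
  ring

lemma besselJ_deriv {ν x : ℝ} (hν : 0 ≤ ν) (hx : 0 < x) :
    HasDerivAt (besselJ ν) ((ν * besselJ ν x - x * besselJ (ν+1) x)/x) x := by
  have h1 : HasDerivAt (fun x : ℝ => (x/2)^ν) ((1/2) * ν * (x/2)^(ν-1)) x := by
    exact ((hasDerivAt_id x).div_const 2).rpow_const (Or.inl (by simp; positivity))
  have h2 : HasDerivAt (fun x : ℝ => x^2/4) (x/2) x := by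
    refine ((hasDerivAt_pow 2 x).div_const 4).congr_deriv ?_
    push_cast; ring
  have h3 := h1.mul ((bslP_hasDeriv hν (x^2/4)).comp x h2)
  have h4 : HasDerivAt (besselJ ν) _ x := h3.congr_of_eventuallyEq (by
    filter_upwards [lt_mem_nhds hx] with z hz
    exact besselJ_eq hz)
  refine h4.congr_deriv ?_
  rw [besselJ_eq hx, besselJ_eq hx]
  have e1 : (x/2)^(ν+1) = (x/2)^ν * (x/2) := Real.rpow_add_one (by positivity) _
  have e2 : (x/2)^(ν-1) = (x/2)^ν / (x/2) := Real.rpow_sub_one (by positivity) _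
  rw [e1, e2]
  simp only [Function.comp]
  field_simp
  ring

/-- The function V, x times the derivative of J. -/
noncomputable def bslV (ν x : ℝ) : ℝ := ν * besselJ ν x - x * besselJ (ν+1) x

lemma besselJ_deriv' {ν x : ℝ} (hν : 0 ≤ ν) (hx : 0 < x) :
    HasDerivAt (besselJ ν) (bslV ν x / x) x := besselJ_deriv hν hx

lemma bslV_deriv {ν x : ℝ} (hν : 0 ≤ ν) (hx : 0 < x) :
    HasDerivAt (bslV ν) ((ν^2 - x^2) / x * besselJ ν x) x := by
  have h1 := (besselJ_deriv hν hx).const_mul ν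
  have h2 := (hasDerivAt_id x).mul (besselJ_deriv (ν := ν+1) (by linarith) hx)
  have h3 := h1.sub h2
  have e := besselJ_rec hν hx
  have e2 : besselJ (ν+1+1) x = besselJ (ν+2) x := by congr 1; ring
  refine h3.congr_deriv ?_
  rw [e2, e]
  simp only [id]
  field_simp
  ring


noncomputable def bslS (ν x : ℝ) : ℝ := √(x^2 - ν^2)
noncomputable def bslF (ν x : ℝ) : ℝ := bslS ν x * besselJ ν x ^ 2 + bslV ν x ^ 2 / bslS ν x
noncomputable def bslc (ν x : ℝ) : ℝ := x^2 / bslS ν x ^ 3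
noncomputable def bslG (ν x : ℝ) : ℝ := bslF ν x + bslc ν x * (besselJ ν x * bslV ν x)

lemma bslS_pos {ν x : ℝ} (h : ν^2 < x^2) : 0 < bslS ν x := Real.sqrt_pos.2 (by linarith)
lemma bslS_sq {ν x : ℝ} (h : ν^2 < x^2) : bslS ν x ^ 2 = x^2 - ν^2 := Real.sq_sqrt (by linarith)

lemma bslS_deriv {ν x : ℝ} (h : ν^2 < x^2) : HasDerivAt (bslS ν) (x / bslS ν x) x := by
  have h1 : HasDerivAt (fun x : ℝ => x^2 - ν^2) (2*x) x := by
    simpa using (hasDerivAt_pow 2 x).sub_const (ν^2)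
  refine (h1.sqrt (by linarith)).congr_deriv ?_
  have := bslS_pos h
  unfold bslS at *
  field_simp

lemma bslc_deriv {ν x : ℝ} (h : ν^2 < x^2) :
    HasDerivAt (bslc ν) (x * (2 * bslS ν x ^ 2 - 3 * x^2) / bslS ν x ^ 5) x := by
  have hS := bslS_pos h
  have h1 := (hasDerivAt_pow 2 x).div ((bslS_deriv h).pow 3) (pow_pos hS 3).ne'
  refine h1.congr_deriv ?_
  push_cast
  simp only [Pi.pow_apply]
  field_simp

lemma bslG_deriv {ν x : ℝ} (hν : 0 ≤ ν) (hx : 0 < x) (h : ν^2 < x^2) :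
    HasDerivAt (bslG ν)
      (x * (2 * bslS ν x ^ 2 - 3 * x^2) / bslS ν x ^ 5 * (besselJ ν x * bslV ν x)) x := by
  have hS := bslS_pos h
  have hS2 := bslS_sq h
  have hJ := besselJ_deriv' hν hx
  have hV := bslV_deriv hν hx
  have h1 := (((bslS_deriv h).mul (hJ.pow 2)).add ((hV.pow 2).div (bslS_deriv h) hS.ne')).add
    ((bslc_deriv h).mul (hJ.mul hV))
  refine h1.congr_deriv ?_
  have e : ν^2 - x^2 = - bslS ν x ^ 2 := by linarith
  rw [e]
  push_cast
  simp only [Pi.pow_apply, Pi.mul_apply, bslc]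
  field_simp
  ring

/-- The region where the WKB analysis works. -/
def bslR (ν x : ℝ) : Prop := 0 < x ∧ ν^2 < x^2 ∧ x^2 ≤ bslS ν x ^ 3

lemma bslF_nonneg {ν x : ℝ} : 0 ≤ bslF ν x := by
  unfold bslF
  have : 0 ≤ bslS ν x := Real.sqrt_nonneg _
  positivity

lemma bsl_JV {ν x : ℝ} (h : ν^2 < x^2) : |besselJ ν x * bslV ν x| ≤ bslF ν x / 2 := by
  have hS := bslS_pos h
  unfold bslF
  generalize besselJ ν x = J
  generalize bslV ν x = V
  generalize bslS ν x = S at *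
  have e : S * J^2 + V^2 / S = (S^2 * J^2 + V^2) / S := by field_simp
  rw [e, div_div, le_div_iff₀ (by positivity)]
  rcases abs_cases (J*V) with ⟨h1, _⟩ | ⟨h1, _⟩ <;> rw [h1] <;>
    nlinarith [sq_nonneg (S*J - V), sq_nonneg (S*J+V)]

lemma bslc_le {ν x : ℝ} (h : bslR ν x) : 0 ≤ bslc ν x ∧ bslc ν x ≤ 1 := by
  have hS := bslS_pos h.2.1
  unfold bslc
  constructor
  · positivity
  · rw [div_le_one (by positivity)]; exact h.2.2

lemma bslG_bd {ν x : ℝ} (h : bslR ν x) :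
    bslF ν x / 2 ≤ bslG ν x ∧ bslG ν x ≤ 3 * bslF ν x / 2 := by
  have h1 := bsl_JV h.2.1
  obtain ⟨c0, c1⟩ := bslc_le h
  have h2 : |bslc ν x * (besselJ ν x * bslV ν x)| ≤ bslF ν x / 2 := by
    rw [abs_mul, abs_of_nonneg c0]
    nlinarith [abs_nonneg (besselJ ν x * bslV ν x)]
  unfold bslG
  constructor <;> linarith [abs_le.1 h2]

lemma bslc'_nonpos {ν x : ℝ} (h : bslR ν x) :
    x * (2 * bslS ν x ^ 2 - 3 * x^2) / bslS ν x ^ 5 ≤ 0 := by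
  have hS := bslS_pos h.2.1
  have hS2 := bslS_sq h.2.1
  apply div_nonpos_of_nonpos_of_nonneg _ (by positivity)
  apply mul_nonpos_of_nonneg_of_nonpos h.1.le
  nlinarith [sq_nonneg x, sq_nonneg ν]

lemma bslG'_bd {ν x : ℝ} (h : bslR ν x) :
    |x * (2 * bslS ν x ^ 2 - 3 * x^2) / bslS ν x ^ 5 * (besselJ ν x * bslV ν x)|
      ≤ - (x * (2 * bslS ν x ^ 2 - 3 * x^2) / bslS ν x ^ 5) * bslG ν x := by
  have h1 := bsl_JV h.2.1
  have h2 := bslc'_nonpos h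
  rw [abs_mul, abs_of_nonpos h2]
  apply mul_le_mul_of_nonneg_left _ (by linarith)
  linarith [(bslG_bd h).1]

lemma bsl_exp {ν x : ℝ} (h : bslR ν x) : Real.exp (bslc ν x) ≤ 3 := by
  have := Real.exp_le_exp.2 (bslc_le h).2
  linarith [Real.exp_one_lt_d9]

lemma bslF_forward {ν x y : ℝ} (hν : 0 ≤ ν) (hxy : x ≤ y) (h : ∀ z ∈ Set.Icc x y, bslR ν z) :
    bslF ν y ≤ 9 * bslF ν x := by
  have hx := h x ⟨le_rfl, hxy⟩
  have hy := h y ⟨hxy, le_rfl⟩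
  have hd : ∀ z ∈ Set.Icc x y, HasDerivAt (fun z => bslG ν z * Real.exp (bslc ν z)) _ z :=
    fun z hz => (bslG_deriv hν (h z hz).1 (h z hz).2.1).mul (bslc_deriv (h z hz).2.1).exp
  have hm : AntitoneOn (fun z => bslG ν z * Real.exp (bslc ν z)) (Set.Icc x y) := by
    refine antitoneOn_of_deriv_nonpos (convex_Icc x y)
      (fun z hz => (hd z hz).continuousAt.continuousWithinAt)
      (fun z hz => (hd z (interior_subset hz)).differentiableAt.differentiableWithinAt) ?_
    intro z hz
    have hz' := h z (interior_subset hz)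
    rw [(hd z (interior_subset hz)).deriv]
    have h1 := (abs_le.1 (bslG'_bd hz')).2
    have h2 := Real.exp_pos (bslc ν z)
    nlinarith
  have h1 := hm ⟨le_rfl, hxy⟩ ⟨hxy, le_rfl⟩ hxy
  simp only at h1
  have h2 := bslG_bd hx
  have h3 := bslG_bd hy
  have h4 := bsl_exp hx
  have h5 : 1 ≤ Real.exp (bslc ν y) := Real.one_le_exp (bslc_le hy).1
  have h6 := bslF_nonneg (ν := ν) (x := x)
  have h7 := bslF_nonneg (ν := ν) (x := y)
  nlinarith

lemma bslF_backward {ν x y : ℝ} (hν : 0 ≤ ν) (hxy : x ≤ y) (h : ∀ z ∈ Set.Icc x y, bslR ν z) :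
    bslF ν x ≤ 9 * bslF ν y := by
  have hx := h x ⟨le_rfl, hxy⟩
  have hy := h y ⟨hxy, le_rfl⟩
  have hd : ∀ z ∈ Set.Icc x y, HasDerivAt (fun z => bslG ν z * Real.exp (- bslc ν z)) _ z :=
    fun z hz => (bslG_deriv hν (h z hz).1 (h z hz).2.1).mul (bslc_deriv (h z hz).2.1).neg.exp
  have hm : MonotoneOn (fun z => bslG ν z * Real.exp (- bslc ν z)) (Set.Icc x y) := by
    refine monotoneOn_of_deriv_nonneg (convex_Icc x y)
      (fun z hz => (hd z hz).continuousAt.continuousWithinAt)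
      (fun z hz => (hd z (interior_subset hz)).differentiableAt.differentiableWithinAt) ?_
    intro z hz
    have hz' := h z (interior_subset hz)
    rw [(hd z (interior_subset hz)).deriv]
    have h1 := (abs_le.1 (bslG'_bd hz')).1
    have h2 := Real.exp_pos (- bslc ν z)
    simp only [Pi.neg_apply]
    nlinarith
  have h1 := hm ⟨le_rfl, hxy⟩ ⟨hxy, le_rfl⟩ hxy
  simp only [Real.exp_neg] at h1
  have h2 := bslG_bd hx
  have h3 := bslG_bd hy
  have h4 := bsl_exp hx
  have h5 : (Real.exp (bslc ν y))⁻¹ ≤ 1 := inv_le_one_of_one_le₀ (Real.one_le_exp (bslc_le hy).1)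
  have h6 := bslF_nonneg (ν := ν) (x := x)
  have h7 := bslF_nonneg (ν := ν) (x := y)
  have h8 : (1:ℝ)/3 ≤ (Real.exp (bslc ν x))⁻¹ := by
    rw [one_div]; exact inv_anti₀ (Real.exp_pos _) h4
  nlinarith

/-- Sufficient condition for the region. -/
lemma bslR_of {ν τ x : ℝ} (hτ : 0 ≤ τ) (hν : ν = τ^3) (hx : 0 < x)
    (h : ν^2 + 4 + 4 * τ^4 ≤ x^2) : bslR ν x ∧ 2 ≤ bslS ν x ∧ 2 * τ^2 ≤ bslS ν x := by
  have hlt : ν^2 < x^2 := by nlinarith [pow_nonneg hτ 4]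
  have hS := bslS_pos hlt
  have hS2 := bslS_sq hlt
  have h2 : 2 ≤ bslS ν x := by nlinarith [pow_nonneg hτ 4]
  have h3 : 2 * τ^2 ≤ bslS ν x := by
    apply le_of_sq_le_sq _ hS.le |> id
    nlinarith [pow_nonneg hτ 4]
  refine ⟨⟨hx, hlt, ?_⟩, h2, h3⟩
  have h4 : (2*τ^2)^3 ≤ bslS ν x ^ 3 := by gcongr
  have h5 : 2 * bslS ν x ^ 2 ≤ bslS ν x ^ 3 := by nlinarith [sq_nonneg (bslS ν x)]
  have e : (2*τ^2)^3 = 8 * ν^2 := by rw [hν]; ring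
  nlinarith [sq_nonneg ν]

/-- Base case constant. -/
lemma bsl_base : ∃ C : ℝ, 0 < C ∧ ∀ ν : ℝ, 0 ≤ ν → ν ≤ 1 → ∀ x : ℝ, 3 ≤ x →
    x * (besselJ ν x ^ 2 + besselJ (ν+1) x ^ 2) ≤ C := by
  obtain ⟨M, hM0, hM⟩ : ∃ M : ℝ, 0 < M ∧ ∀ ν : ℝ, 0 ≤ ν → ν ≤ 2 → |besselJ ν 3| ≤ M := by
    refine ⟨2 * Real.exp (3^2/4) * (3/2)^(2:ℝ), by positivity, fun ν h0 h2 => ?_⟩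
    refine (besselJ_crude h0 (by norm_num)).trans ?_
    gcongr
    norm_num
  refine ⟨36 * (3 * M^2 + 8 * M^2 + 100 * M^2), by positivity, fun ν h0 h1 x hx => ?_⟩
  set τ := ν ^ ((1:ℝ)/3)
  have hτ : 0 ≤ τ := Real.rpow_nonneg h0 _
  have hτ3 : ν = τ^3 := by
    simp only [τ]
    rw [← Real.rpow_natCast, ← Real.rpow_mul h0]; norm_num
  have hτ1 : τ ≤ 1 := Real.rpow_le_one h0 h1 (by norm_num)
  have hτ4 : τ^4 ≤ 1 := pow_le_one₀ hτ hτ1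
  have hR : ∀ z : ℝ, 3 ≤ z → bslR ν z ∧ 2 ≤ bslS ν z ∧ 2 * τ^2 ≤ bslS ν z := by
    intro z hz
    apply bslR_of hτ hτ3 (by linarith)
    nlinarith
  have h3 : bslF ν 3 ≤ 3 * M^2 + 8 * M^2 + 100 * M^2 := by
    have hS := (hR 3 le_rfl).2.1
    have hS2 := bslS_sq (hR 3 le_rfl).1.2.1
    have hS3 : bslS ν 3 ≤ 3 := by nlinarith
    have a1 : besselJ ν 3 ^ 2 ≤ M^2 := sq_le_sq' (abs_le.1 (hM ν h0 (by linarith))).1 (abs_le.1 (hM ν h0 (by linarith))).2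
    have a2 := hM ν h0 (by linarith)
    have a3 := hM (ν+1) (by linarith) (by linarith)
    have a4 : |bslV ν 3| ≤ 4 * M := by
      unfold bslV
      refine (abs_sub _ _).trans ?_
      rw [abs_mul, abs_mul, abs_of_nonneg h0, abs_of_nonneg (by norm_num : (0:ℝ) ≤ 3)]
      nlinarith [abs_nonneg (besselJ ν 3)]
    have a5 : bslV ν 3 ^ 2 ≤ (4*M)^2 := sq_le_sq' (abs_le.1 a4).1 (abs_le.1 a4).2
    have a6 : bslV ν 3 ^ 2 / bslS ν 3 ≤ (4*M)^2 / 2 := by gcongr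
    unfold bslF
    nlinarith
  have hF := bslF_forward h0 hx (fun z hz => (hR z hz.1).1)
  obtain ⟨hr, hS, -⟩ := hR x hx
  have hS2 := bslS_sq hr.2.1
  have hx0 : 0 < x := by linarith
  have b1 : x ≤ 2 * bslS ν x := by nlinarith
  have b2 : bslS ν x ≤ x := by nlinarith
  have b3 : x * besselJ (ν+1) x ^ 2 = (ν * besselJ ν x - bslV ν x)^2 / x := by
    unfold bslV; field_simp; ring
  have b4 : (ν * besselJ ν x - bslV ν x)^2 / x ≤ 2 * bslF ν x := by
    have : (ν * besselJ ν x - bslV ν x)^2 ≤ 2 * besselJ ν x ^ 2 + 2 * bslV ν x ^ 2 := by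
      have : ν^2 * besselJ ν x ^ 2 ≤ 1 * besselJ ν x ^ 2 := by
        gcongr; nlinarith
      nlinarith [sq_nonneg (ν * besselJ ν x + bslV ν x)]
    calc _ ≤ (2 * besselJ ν x ^ 2 + 2 * bslV ν x ^ 2) / bslS ν x := by gcongr
      _ = 2 * (1 / bslS ν x * besselJ ν x ^ 2 + bslV ν x ^ 2 / bslS ν x) := by ring
      _ ≤ _ := by
        unfold bslF
        have : 1 / bslS ν x ≤ bslS ν x := by
          rw [div_le_iff₀ (by linarith)]; nlinarith
        gcongr
  have b5 : x * besselJ ν x ^ 2 ≤ 2 * bslF ν x := by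
    have : 0 ≤ bslV ν x ^ 2 / bslS ν x := by positivity
    unfold bslF
    nlinarith [sq_nonneg (besselJ ν x)]
  nlinarith

lemma bsl_ladder {C μ : ℝ} (hμ : 0 ≤ μ)
    (h : ∀ x : ℝ, 3 ≤ x → x * (besselJ μ x ^ 2 + besselJ (μ+1) x ^ 2) ≤ C) (k : ℕ) :
    ∀ M > C, ∀ᶠ x in Filter.atTop,
      x * (besselJ (μ+k) x ^ 2 + besselJ (μ+k+1) x ^ 2) ≤ M := by
  induction k with
  | zero =>
    intro M hM
    filter_upwards [Filter.eventually_ge_atTop 3] with x hx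
    simpa using (h x hx).trans hM.le
  | succ k ih =>
    intro M hM
    set ν := μ + k with hν
    have hν0 : 0 ≤ ν := by positivity
    have e1 : μ + ((k+1 : ℕ) : ℝ) = ν + 1 := by push_cast; ring
    rw [e1]
    have e2 : ν + 1 + 1 = ν + 2 := by ring
    rw [e2]
    set M' := (M + C)/2
    have hM' : C < M' := by simp only [M']; linarith
    have hM'' : M' < M := by simp only [M']; linarith
    have ht : Filter.Tendsto (fun x : ℝ => (1 + 2*(ν+1)/x + (2*(ν+1)/x)^2) * M') Filter.atTop
        (nhds ((1 + 0 + 0^2) * M')) := by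
      have : Filter.Tendsto (fun x : ℝ => 2*(ν+1)/x) Filter.atTop (nhds 0) :=
        tendsto_const_nhds.div_atTop Filter.tendsto_id
      exact ((tendsto_const_nhds.add this).add (this.pow 2)).mul_const _
    have ht' := ht.eventually_lt_const (u := M) (by linarith)
    filter_upwards [ih M' hM', ht', Filter.eventually_gt_atTop 0] with x h1 h2 hx
    rw [besselJ_rec hν0 hx]
    have hδ : 0 ≤ 2*(ν+1)/x := by positivity
    set δ := 2*(ν+1)/x
    generalize besselJ ν x = J at *
    generalize besselJ (ν+1) x = K at *
    have h3 : K^2 + (δ * K - J)^2 ≤ (1 + δ + δ^2) * (J^2+K^2) := by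
      nlinarith [mul_nonneg hδ (sq_nonneg (J + K)), mul_nonneg (sq_nonneg δ) (sq_nonneg J)]
    calc _ ≤ x * ((1 + δ + δ^2) * (J^2+K^2)) := by gcongr
      _ = (1 + δ + δ^2) * (x * (J^2+K^2)) := by ring
      _ ≤ (1 + δ + δ^2) * M' := by gcongr
      _ ≤ M := h2.le

lemma bsl_region : ∃ C : ℝ, 0 < C ∧ ∀ ν τ x : ℝ, 0 ≤ τ → ν = τ^3 → 0 < x →
    ν^2 + 4 + 4 * τ^4 ≤ x^2 → bslF ν x ≤ C := by
  obtain ⟨C, hC, hb⟩ := bsl_base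
  refine ⟨9 * (5 * (2*C)), by positivity, fun ν τ x hτ hν hx h => ?_⟩
  have hν0 : 0 ≤ ν := by rw [hν]; positivity
  set k := ⌊ν⌋₊
  have hk1 : (k:ℝ) ≤ ν := Nat.floor_le hν0
  have hk2 : ν < k + 1 := Nat.lt_floor_add_one ν
  have hl := bsl_ladder (μ := ν - k) (by linarith)
    (hb (ν - k) (by linarith) (by linarith)) k (2*C) (by linarith)
  have e : ν - k + k = ν := by ring
  rw [e] at hl
  obtain ⟨y, hy1, hy2, hy3⟩ := (hl.and ((Filter.eventually_ge_atTop (2*ν)).and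
    (Filter.eventually_ge_atTop x))).exists
  have hR : ∀ z : ℝ, x ≤ z → bslR ν z ∧ 2 ≤ bslS ν z ∧ 2 * τ^2 ≤ bslS ν z := by
    intro z hz
    apply bslR_of hτ hν (by linarith)
    nlinarith
  have hF := bslF_backward hν0 hy3 (fun z hz => (hR z hz.1).1)
  refine hF.trans ?_
  gcongr
  obtain ⟨hr, hS, -⟩ := hR y hy3
  have hS2 := bslS_sq hr.2.1
  have hy0 := hr.1
  have b1 : y ≤ 2 * bslS ν y := by nlinarith
  have b2 : bslS ν y ≤ y := by nlinarith
  have b3 : bslV ν y ^ 2 / bslS ν y ≤ 2 * bslV ν y ^ 2 / y := by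
    rw [div_le_div_iff₀ (by linarith) hy0]
    nlinarith [sq_nonneg (bslV ν y)]
  have b4 : 2 * bslV ν y ^ 2 / y ≤ y * (4 * (besselJ ν y ^ 2 + besselJ (ν+1) y ^ 2)) := by
    rw [div_le_iff₀ hy0]
    unfold bslV
    generalize besselJ ν y = J at *
    generalize besselJ (ν+1) y = K at *
    have : ν^2 * J^2 ≤ y^2 * J^2 := by gcongr; linarith
    nlinarith [sq_nonneg (ν * J + y * K)]
  have b5 : bslS ν y * besselJ ν y ^ 2 ≤ y * besselJ ν y ^ 2 := by gcongr
  have b6 : 0 ≤ y * besselJ (ν+1) y ^ 2 := by positivity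
  unfold bslF
  linarith


noncomputable def bslE (ν x : ℝ) : ℝ := (x^2 - ν^2) * besselJ ν x ^ 2 + bslV ν x ^ 2

lemma bslE_deriv {ν x : ℝ} (hν : 0 ≤ ν) (hx : 0 < x) :
    HasDerivAt (bslE ν) (2 * x * besselJ ν x ^ 2) x := by
  have h1 : HasDerivAt (fun x : ℝ => x^2 - ν^2) (2*x) x := by
    simpa using (hasDerivAt_pow 2 x).sub_const (ν^2)
  have hJ := besselJ_deriv' hν hx
  have hV := bslV_deriv hν hx
  refine ((h1.mul (hJ.pow 2)).add (hV.pow 2)).congr_deriv ?_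
  push_cast
  simp only [Pi.pow_apply]
  field_simp
  ring

lemma bslE_mono {ν x y : ℝ} (hν : 0 ≤ ν) (hx : 0 < x) (hxy : x ≤ y) : bslE ν x ≤ bslE ν y := by
  have hm : MonotoneOn (bslE ν) (Set.Ioi 0) := by
    refine monotoneOn_of_deriv_nonneg (convex_Ioi 0)
      (fun z hz => (bslE_deriv hν hz).continuousAt.continuousWithinAt)
      (fun z hz => (bslE_deriv hν (interior_subset hz)).differentiableAt.differentiableWithinAt) ?_
    intro z hz
    have hz' : 0 < z := interior_subset hz
    rw [(bslE_deriv hν hz').deriv]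
    positivity
  exact hm hx (hx.trans_le hxy) hxy

lemma besselJ_tendsto {ν : ℝ} (hν : 0 < ν) :
    Filter.Tendsto (besselJ ν) (nhdsWithin 0 (Set.Ioi 0)) (nhds 0) := by
  have h1 : Filter.Tendsto (fun x : ℝ => 2 * Real.exp (x^2/4) * (x/2)^ν) (nhdsWithin 0 (Set.Ioi 0))
      (nhds 0) := by
    have : Continuous (fun x : ℝ => 2 * Real.exp (x^2/4) * (x/2)^ν) := by
      have : Continuous (fun x : ℝ => (x/2)^ν) :=
        (continuous_id.div_const 2).rpow_const (fun _ => Or.inr hν.le)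
      fun_prop
    have h := this.tendsto 0
    simp only [zero_div, Real.zero_rpow hν.ne', mul_zero] at h
    exact h.mono_left nhdsWithin_le_nhds
  refine squeeze_zero_norm' ?_ h1
  filter_upwards [self_mem_nhdsWithin] with x hx
  exact besselJ_crude hν.le hx

lemma bslV_tendsto {ν : ℝ} (hν : 0 < ν) :
    Filter.Tendsto (bslV ν) (nhdsWithin 0 (Set.Ioi 0)) (nhds 0) := by
  have h1 := (besselJ_tendsto hν).const_mul ν
  have hid : Filter.Tendsto (fun x : ℝ => x) (nhdsWithin 0 (Set.Ioi 0)) (nhds 0) :=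
    Filter.tendsto_id.mono_left nhdsWithin_le_nhds
  have h2 := hid.mul (besselJ_tendsto (ν := ν+1) (by linarith))
  have h3 := h1.sub h2
  simp only [mul_zero, sub_zero] at h3
  exact h3

lemma bslE_nonneg {ν x : ℝ} (hν : 0 < ν) (hx : 0 < x) : 0 ≤ bslE ν x := by
  have hid : Filter.Tendsto (fun x : ℝ => x) (nhdsWithin 0 (Set.Ioi 0)) (nhds 0) :=
    Filter.tendsto_id.mono_left nhdsWithin_le_nhds
  have h1 := (((hid.pow 2).sub_const (ν^2)).mul ((besselJ_tendsto hν).pow 2)).add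
    ((bslV_tendsto hν).pow 2)
  have h2 : Filter.Tendsto (bslE ν) (nhdsWithin 0 (Set.Ioi 0)) (nhds 0) := by
    have e : ((0:ℝ)^2 - ν^2) * 0^2 + 0^2 = 0 := by ring
    rw [e] at h1
    exact h1
  refine le_of_tendsto h2 ?_
  filter_upwards [self_mem_nhdsWithin, mem_nhdsWithin_of_mem_nhds (gt_mem_nhds hx)] with z hz hzx
  exact bslE_mono hν.le hz hzx.le

lemma bslW_deriv {ν x : ℝ} (hν : 0 ≤ ν) (hx : 0 < x) :
    HasDerivAt (fun x => besselJ ν x * bslV ν x)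
      (bslV ν x ^ 2 / x + (ν^2 - x^2) / x * besselJ ν x ^ 2) x := by
  refine ((besselJ_deriv' hν hx).mul (bslV_deriv hν hx)).congr_deriv ?_
  ring

lemma bslW_nonneg {ν x : ℝ} (hν : 0 < ν) (hx : 0 < x) (hxν : x ≤ ν) :
    0 ≤ besselJ ν x * bslV ν x := by
  have hm : MonotoneOn (fun x => besselJ ν x * bslV ν x) (Set.Ioc 0 ν) := by
    refine monotoneOn_of_deriv_nonneg (convex_Ioc 0 ν)
      (fun z hz => (bslW_deriv hν.le hz.1).continuousAt.continuousWithinAt)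
      (fun z hz => (bslW_deriv hν.le
        (interior_subset hz).1).differentiableAt.differentiableWithinAt) ?_
    intro z hz
    have hz' : z ∈ Set.Ioc 0 ν := interior_subset hz
    have h0 := hz'.1
    rw [(bslW_deriv hν.le h0).deriv]
    have : 0 ≤ ν^2 - z^2 := by nlinarith [hz'.2]
    positivity
  have h1 := (besselJ_tendsto hν).mul (bslV_tendsto hν)
  rw [mul_zero] at h1
  refine le_of_tendsto h1 ?_
  filter_upwards [self_mem_nhdsWithin, mem_nhdsWithin_of_mem_nhds (gt_mem_nhds hx)] with z hz hzx
  exact hm ⟨hz, hzx.le.trans hxν⟩ ⟨hx, hxν⟩ hzx.le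

lemma bslW_ge {ν x t : ℝ} (hν : 0 < ν) (hx : 0 < x) (hxν : x ≤ ν) (ht : t^2 ≤ ν^2 - x^2) :
    t * besselJ ν x ^ 2 ≤ besselJ ν x * bslV ν x := by
  have h1 := bslW_nonneg hν hx hxν
  have h2 := bslE_nonneg hν hx
  unfold bslE at h2
  have h3 : (t * besselJ ν x)^2 ≤ bslV ν x ^ 2 := by
    nlinarith [mul_le_mul_of_nonneg_right ht (sq_nonneg (besselJ ν x))]
  by_contra hcon
  push Not at hcon
  have h4 : (besselJ ν x * bslV ν x)^2 < (t * besselJ ν x ^ 2)^2 := by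
    apply pow_lt_pow_left₀ hcon h1 (by norm_num)
  nlinarith [mul_le_mul_of_nonneg_right h3 (sq_nonneg (besselJ ν x))]

lemma bslJ2_deriv {ν x : ℝ} (hν : 0 ≤ ν) (hx : 0 < x) :
    HasDerivAt (fun x => besselJ ν x ^ 2) (2 * (besselJ ν x * bslV ν x) / x) x := by
  refine ((besselJ_deriv' hν hx).pow 2).congr_deriv ?_
  push_cast; ring

lemma bslJ2_mono {ν x y : ℝ} (hν : 0 < ν) (hx : 0 < x) (hxy : x ≤ y) (hy : y ≤ ν) :
    besselJ ν x ^ 2 ≤ besselJ ν y ^ 2 := by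
  have hm : MonotoneOn (fun x => besselJ ν x ^ 2) (Set.Ioc 0 ν) := by
    refine monotoneOn_of_deriv_nonneg (convex_Ioc 0 ν)
      (fun z hz => (bslJ2_deriv hν.le hz.1).continuousAt.continuousWithinAt)
      (fun z hz => (bslJ2_deriv hν.le
        (interior_subset hz).1).differentiableAt.differentiableWithinAt) ?_
    intro z hz
    have hz' : z ∈ Set.Ioc 0 ν := interior_subset hz
    have h0 := hz'.1
    rw [(bslJ2_deriv hν.le h0).deriv]
    have := bslW_nonneg hν h0 hz'.2
    positivity
  exact hm ⟨hx, hxy.trans hy⟩ ⟨hx.trans_le hxy, hy⟩ hxy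

lemma bsl_region_J : ∃ C : ℝ, 0 < C ∧ ∀ ν τ x : ℝ, 0 ≤ τ → ν = τ^3 → 0 < x →
    ν^2 + 4 + 4 * τ^4 ≤ x^2 → besselJ ν x ^ 2 * bslS ν x ≤ C ∧ bslE ν x ≤ C * bslS ν x := by
  obtain ⟨C, hC, h⟩ := bsl_region
  refine ⟨C, hC, fun ν τ x hτ hν hx hr => ?_⟩
  have h1 := h ν τ x hτ hν hx hr
  obtain ⟨hR, hS, -⟩ := bslR_of hτ hν hx hr
  have hS2 := bslS_sq hR.2.1
  have hS0 : 0 < bslS ν x := by linarith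
  have e : bslE ν x = bslF ν x * bslS ν x := by
    unfold bslE bslF
    rw [← hS2]; field_simp
  constructor
  · have : 0 ≤ bslV ν x ^ 2 / bslS ν x := by positivity
    unfold bslF at h1
    linarith
  · rw [e]; gcongr

lemma bsl_low : ∃ C : ℝ, 0 < C ∧ ∀ ν τ x : ℝ, 1 ≤ τ → ν = τ^3 → 0 < x →
    x^2 ≤ ν^2 + 4 + 4 * τ^4 → |besselJ ν x| ≤ C / τ := by
  obtain ⟨C, hC, h⟩ := bsl_region_J
  obtain ⟨M, hM, hMC⟩ : ∃ M : ℝ, 0 < M ∧ M^2 = C := ⟨√C, Real.sqrt_pos.2 hC, Real.sq_sqrt hC.le⟩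
  refine ⟨9 * M, by positivity, fun ν τ x hτ hν hx hr => ?_⟩
  have hτ0 : 0 < τ := by linarith
  have hν1 : 1 ≤ ν := by rw [hν]; exact one_le_pow₀ hτ
  have hτ4 : 1 ≤ τ^4 := one_le_pow₀ hτ
  set r := √(ν^2 + 4 + 4 * τ^4) with hrdef
  have hr2 : r^2 = ν^2 + 4 + 4 * τ^4 := Real.sq_sqrt (by positivity)
  have hr0 : 0 < r := Real.sqrt_pos.2 (by positivity)
  obtain ⟨hJr, hEr⟩ := h ν τ r hτ0.le hν hr0 hr2.ge
  obtain ⟨hR, hS, hSτ⟩ := bslR_of hτ0.le hν hr0 hr2.ge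
  have hS2 := bslS_sq hR.2.1
  have hνr : ν < r := by nlinarith
  have hS3 : bslS ν r ≤ 3 * τ^2 := by
    apply abs_le_of_sq_le_sq' _ (by positivity) |>.2
    nlinarith
  have hlen : r - ν ≤ 4 * τ := by
    have : (r - ν) * (2 * ν) ≤ 8 * τ^4 := by nlinarith
    rw [hν] at this ⊢
    have h3 : 0 < 2 * τ^3 := by positivity
    have : (r - τ^3) * (2*τ^3) ≤ (4 * τ) * (2*τ^3) := by linarith
    exact le_of_mul_le_mul_right this h3
  have hJr' : |besselJ ν r| ≤ M / τ := by
    apply abs_le_of_sq_le_sq _ (by positivity)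
    rw [div_pow, le_div_iff₀ (by positivity), hMC]
    nlinarith [sq_nonneg (besselJ ν r)]
  have hmid : ∀ z, ν ≤ z → z ≤ r → |besselJ ν z| ≤ 9 * M / τ := by
    intro z hz1 hz2
    have hd : ∀ y ∈ Set.Icc ν r, ‖deriv (besselJ ν) y‖ ≤ 2 * M / τ^2 := by
      intro y hy
      have hy0 : 0 < y := by linarith [hy.1]
      rw [(besselJ_deriv' (by linarith) hy0).deriv, Real.norm_eq_abs, abs_div, abs_of_pos hy0]
      have h1 := bslE_mono (ν := ν) (by linarith) hy0 hy.2
      have h2 : bslV ν y ^ 2 ≤ (2 * M * τ)^2 := by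
        have : 0 ≤ (y^2 - ν^2) * besselJ ν y ^ 2 := by
          apply mul_nonneg _ (sq_nonneg _); nlinarith [hy.1]
        have h3 : bslV ν y ^ 2 ≤ C * (3 * τ^2) := by
          have : C * bslS ν r ≤ C * (3 * τ^2) := by gcongr
          unfold bslE at h1 hEr
          linarith
        nlinarith [sq_nonneg τ, mul_nonneg hC.le (sq_nonneg τ)]
      have h3 := abs_le_of_sq_le_sq h2 (by positivity)
      calc |bslV ν y| / y ≤ (2 * M * τ) / τ^3 := by
            gcongr
            rw [← hν]; exact hy.1
        _ = _ := by field_simp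
    have := (convex_Icc ν r).norm_image_sub_le_of_norm_deriv_le (f := besselJ ν)
      (fun y hy => (besselJ_deriv' (by linarith)
        (by linarith [hy.1] : 0 < y)).differentiableAt) hd
      (x := r) (y := z) ⟨hνr.le, le_rfl⟩ ⟨hz1, hz2⟩
    rw [Real.norm_eq_abs, Real.norm_eq_abs, abs_sub_comm z r, abs_of_nonneg (by linarith : 0 ≤ r - z)] at this
    have h4 : 2 * M / τ^2 * (r - z) ≤ 8 * M / τ := by
      calc _ ≤ 2 * M / τ^2 * (4 * τ) := by gcongr; linarith
        _ = _ := by field_simp; ring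
    have h5 := abs_sub_abs_le_abs_sub (besselJ ν z) (besselJ ν r)
    have h6 : 9 * M / τ = 8 * M / τ + M / τ := by ring
    linarith
  rcases le_total ν x with hc | hc
  · exact hmid x hc (by rw [hrdef]; exact Real.le_sqrt_of_sq_le hr)
  · have := bslJ2_mono (by linarith) hx hc le_rfl
    exact (sq_le_sq.1 this).trans (hmid ν le_rfl hνr.le)

lemma bsl_low_int {ν τ D : ℝ} (hτ : 1 ≤ τ) (hν : ν = τ^3)
    (hD : ∀ x : ℝ, 0 < x → x ≤ ν → |besselJ ν x| ≤ D) :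
    ∫⁻ x in Set.Ioc 1 (ν - τ/2), ENNReal.ofReal (besselJ ν x ^ 2 / x)
      ≤ ENNReal.ofReal (D^2 / τ^2) := by
  have hτ0 : 0 < τ := by linarith
  have hν0 : 0 < ν := by rw [hν]; positivity
  set b := ν - τ/2 with hb
  rcases le_or_gt b 1 with hb1 | hb1
  · rw [Set.Ioc_eq_empty (by linarith)]; simp
  have hpos : ∀ x ∈ Set.Icc 1 b, 0 < x := fun x hx => by linarith [hx.1]
  have hcJ : ContinuousOn (besselJ ν) (Set.Icc 1 b) := fun x hx =>
    (besselJ_deriv' hν0.le (hpos x hx)).continuousAt.continuousWithinAt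
  have hcV : ContinuousOn (bslV ν) (Set.Icc 1 b) := fun x hx =>
    (bslV_deriv hν0.le (hpos x hx)).continuousAt.continuousWithinAt
  have hc1 : ContinuousOn (fun x => 2 * (besselJ ν x * bslV ν x) / x) (Set.Icc 1 b) :=
    ((continuousOn_const.mul (hcJ.mul hcV)).div continuousOn_id (fun x hx => (hpos x hx).ne'))
  have hc2 : ContinuousOn (fun x => besselJ ν x ^ 2 / x) (Set.Icc 1 b) :=
    (hcJ.pow 2).div continuousOn_id (fun x hx => (hpos x hx).ne')
  have hFTC := intervalIntegral.integral_eq_sub_of_hasDerivAt (a := 1) (b := b)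
    (f := fun x => besselJ ν x ^ 2) (fun x hx => bslJ2_deriv hν0.le
      (hpos x (by rwa [Set.uIcc_of_le hb1.le] at hx)))
    (hc1.intervalIntegrable_of_Icc hb1.le)
  have hle : ∫ x in (1:ℝ)..b, besselJ ν x ^ 2 / x ≤ D^2 / τ^2 := by
    have h1 : ∫ x in (1:ℝ)..b, τ^2 * (besselJ ν x ^ 2 / x)
        ≤ ∫ x in (1:ℝ)..b, 2 * (besselJ ν x * bslV ν x) / x := by
      apply intervalIntegral.integral_mono_on hb1.le
        ((continuousOn_const.mul hc2).intervalIntegrable_of_Icc hb1.le)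
        (hc1.intervalIntegrable_of_Icc hb1.le)
      intro x hx
      have hx0 := hpos x hx
      have hxν : x ≤ ν := by linarith [hx.2]
      have := bslW_ge (t := τ^2/2) hν0 hx0 hxν (by
        have : τ/2 * ν ≤ (ν - x) * (ν + x) := by
          apply mul_le_mul <;> linarith [hx.2]
        have e : τ / 2 * ν = τ^4/2 := by rw [hν]; ring
        nlinarith [pow_pos hτ0 4])
      change τ^2 * (besselJ ν x ^ 2 / x) ≤ _
      rw [← mul_div_assoc]
      exact div_le_div_of_nonneg_right (by linarith) hx0.le
    rw [intervalIntegral.integral_const_mul, hFTC] at h1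
    have h2 := hD b (by linarith) (by linarith)
    have h3 : besselJ ν b ^ 2 ≤ D^2 := sq_le_sq' (abs_le.1 h2).1 (abs_le.1 h2).2
    rw [le_div_iff₀ (by positivity)]
    nlinarith [sq_nonneg (besselJ ν 1)]
  rw [← ofReal_integral_eq_lintegral_ofReal, ← intervalIntegral.integral_of_le hb1.le]
  · exact ENNReal.ofReal_le_ofReal hle
  · exact (hc2.integrableOn_Icc).mono_set Set.Ioc_subset_Icc_self
  · refine (ae_restrict_iff' measurableSet_Ioc).2 (Filter.Eventually.of_forall fun x hx => ?_)
    have : 0 < x := by linarith [hx.1]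
    simp only [Pi.zero_apply]
    positivity


lemma bsl_rpow_bd {α t : ℝ} (h1 : 1/3 ≤ t) (h2 : t ≤ 3) : t ^ α ≤ 3 ^ |α| := by
  rcases le_total 0 α with h | h
  · rw [abs_of_nonneg h]
    exact Real.rpow_le_rpow (by linarith) h2 h
  · rw [abs_of_nonpos h, Real.rpow_neg (by norm_num), ← Real.inv_rpow (by norm_num)]
    exact Real.rpow_le_rpow_of_nonpos (by norm_num) (by linarith) h

/-- majorant -/
noncomputable def bslH (β e t : ℝ) : ENNReal :=
  (Set.Ioc (0:ℝ) 1).indicator (fun t => ENNReal.ofReal (t ^ (-β))) t +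
  (Set.Ioi (1:ℝ)).indicator (fun t => ENNReal.ofReal (t ^ (e-β))) t

lemma bslH_fin {β e : ℝ} (hβ : β < 1) (he : e - β < -1) : ∫⁻ t, bslH β e t < ⊤ := by
  unfold bslH
  rw [lintegral_add_left, lintegral_indicator measurableSet_Ioc, lintegral_indicator measurableSet_Ioi]
  · apply ENNReal.add_lt_top.2 ⟨?_, ?_⟩
    · have : IntegrableOn (fun t : ℝ => t ^ (-β)) (Set.Ioc 0 1) := by
        rw [← intervalIntegrable_iff_integrableOn_Ioc_of_le zero_le_one]
        exact intervalIntegral.intervalIntegrable_rpow' (by linarith)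
      exact this.lintegral_lt_top
    · have : IntegrableOn (fun t : ℝ => t ^ (e-β)) (Set.Ioi 1) :=
        integrableOn_Ioi_rpow_of_lt he zero_lt_one
      exact this.lintegral_lt_top
  · refine Measurable.indicator ?_ measurableSet_Ioc
    fun_prop

lemma bsl_reg1 {n : ℕ} (hn : 2 ≤ n) {q : ℝ} (hq : 2 < q) {ν : ℝ} (hν : ((n:ℝ)-2)/2 ≤ ν) :
    ∫⁻ x in Set.Ioc 0 1, ENNReal.ofReal
      (x ^ (-(q * ((n : ℝ) - 2)) / 2 + (n : ℝ) - 1) * |besselJ ν x| ^ q)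
      ≤ ENNReal.ofReal ((2 * Real.exp 1) ^ q) := by
  have hn' : (2:ℝ) ≤ n := by exact_mod_cast hn
  have hν0 : 0 ≤ ν := by linarith
  calc _ ≤ ∫⁻ x in Set.Ioc (0:ℝ) 1, ENNReal.ofReal ((2 * Real.exp 1) ^ q) := by
        refine setLIntegral_mono' measurableSet_Ioc fun x hx => ENNReal.ofReal_le_ofReal ?_
        have hx0 := hx.1
        have h1 : |besselJ ν x| ≤ 2 * Real.exp 1 * x ^ (((n:ℝ)-2)/2) := by
          refine (besselJ_crude hν0 hx0).trans ?_
          have a1 : Real.exp (x^2/4) ≤ Real.exp 1 := Real.exp_le_exp.2 (by nlinarith [hx.2])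
          have a2 : (x/2)^ν ≤ x ^ (((n:ℝ)-2)/2) :=
            (Real.rpow_le_rpow (by positivity) (by linarith) hν0).trans
              (Real.rpow_le_rpow_of_exponent_ge hx0 hx.2 hν)
          gcongr
        calc _ ≤ x ^ (-(q * ((n : ℝ) - 2)) / 2 + (n : ℝ) - 1) *
              (2 * Real.exp 1 * x ^ (((n:ℝ)-2)/2)) ^ q := by gcongr
          _ = (2 * Real.exp 1) ^ q * x ^ ((n:ℝ) - 1) := by
            rw [Real.mul_rpow (by positivity) (by positivity), ← Real.rpow_mul hx0.le]
            rw [mul_left_comm, ← Real.rpow_add hx0]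
            congr 2; ring
          _ ≤ (2 * Real.exp 1) ^ q * 1 := by
            gcongr
            exact Real.rpow_le_one hx0.le hx.2 (by linarith)
          _ = _ := mul_one _
    _ = _ := by simp

/-- Oscillatory region. -/
lemma bsl_reg4 {q α β e : ℝ} (hβ0 : 0 ≤ β) (hβq : β ≤ q/4) (he : e = α - q/3 + β/3)
    (he0 : e ≤ 0) (hq : 0 < q) {C : ℝ}
    (hC : ∀ ν τ x : ℝ, 0 ≤ τ → ν = τ^3 → 0 < x →
    ν^2 + 4 + 4 * τ^4 ≤ x^2 → besselJ ν x ^ 2 * bslS ν x ≤ C ∧ bslE ν x ≤ C * bslS ν x)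
    (hC0 : 0 < C)
    {ν τ : ℝ} (hτ : 0 ≤ τ) (hν : ν = τ^3) :
    ∫⁻ x in {x : ℝ | 0 < x ∧ ν^2 + 4 + 4 * τ^4 ≤ x^2},
      ENNReal.ofReal (x ^ α * |besselJ ν x| ^ q)
      ≤ ENNReal.ofReal (C ^ (q/2)) * ∫⁻ t, bslH β e t := by
  have hν0 : 0 ≤ ν := by rw [hν]; positivity
  have hmeas : MeasurableSet {x : ℝ | 0 < x ∧ ν^2 + 4 + 4 * τ^4 ≤ x^2} := by
    apply MeasurableSet.inter measurableSet_Ioi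
    exact measurableSet_le measurable_const (measurable_id.pow_const 2)
  calc _ ≤ ∫⁻ x in {x : ℝ | 0 < x ∧ ν^2 + 4 + 4 * τ^4 ≤ x^2},
        ENNReal.ofReal (C ^ (q/2)) * bslH β e (x - ν) := by
        refine setLIntegral_mono' hmeas fun x hx => ?_
        obtain ⟨hx0, hx1⟩ := hx
        obtain ⟨hR, hS, -⟩ := bslR_of hτ hν hx0 hx1
        have hJ := (hC ν τ x hτ hν hx0 hx1).1
        have hS2 := bslS_sq hR.2.1
        have hS3 := hR.2.2
        have hS0 : 0 < bslS ν x := by linarith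
        have hxν : ν < x := by
          have := hR.2.1
          nlinarith
        have hx2 : 1 ≤ x := by nlinarith [pow_nonneg hτ 4, sq_nonneg ν]
        have hxν0 : 0 < x - ν := by linarith
        have key : x ^ α * |besselJ ν x| ^ q ≤ C ^ (q/2) * (x ^ e * (x - ν) ^ (-β)) := by
          set S := bslS ν x
          have k1 : |besselJ ν x| ^ q ≤ C ^ (q/2) * S ^ (-(q/2)) := by
            have : |besselJ ν x| ^ q = (besselJ ν x ^ 2) ^ (q/2) := by
              rw [← sq_abs, ← Real.rpow_natCast, ← Real.rpow_mul (abs_nonneg _)]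
              congr 1; push_cast; ring
            rw [this, Real.rpow_neg hS0.le, ← Real.inv_rpow hS0.le, ← Real.mul_rpow hC0.le (by positivity)]
            apply Real.rpow_le_rpow (sq_nonneg _) _ (by linarith)
            rw [← div_eq_mul_inv, le_div_iff₀ hS0]; exact hJ
          have k2 : S ^ (-(q/2)) = (S^3) ^ (-(q/2-2*β)/3) * (S^2) ^ (-β) := by
            rw [← Real.rpow_natCast, ← Real.rpow_natCast, ← Real.rpow_mul hS0.le, ← Real.rpow_mul hS0.le,
              ← Real.rpow_add hS0]
            congr 1; push_cast; ring
          have k3 : (S^3) ^ (-(q/2-2*β)/3) ≤ (x^2) ^ (-(q/2-2*β)/3) :=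
            Real.rpow_le_rpow_of_nonpos (by positivity) hS3 (by linarith)
          have k4 : (S^2) ^ (-β) ≤ (x * (x - ν)) ^ (-β) :=
            Real.rpow_le_rpow_of_nonpos (by positivity) (by nlinarith) (by linarith)
          calc _ ≤ x ^ α * (C ^ (q/2) * ((x^2) ^ (-(q/2-2*β)/3) * (x * (x - ν)) ^ (-β))) := by
                gcongr
                refine k1.trans ?_
                rw [k2]
                gcongr
            _ = C ^ (q/2) * (x ^ e * (x - ν) ^ (-β)) := by
                rw [Real.mul_rpow hx0.le hxν0.le, ← Real.rpow_natCast, ← Real.rpow_mul hx0.le]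
                have : x ^ e = x ^ α * (x ^ (((2:ℕ):ℝ) * (-(q/2-2*β)/3)) * x ^ (-β)) := by
                  rw [← Real.rpow_add hx0, ← Real.rpow_add hx0]
                  congr 1; rw [he]; push_cast; ring
                rw [this]; ring
        refine (ENNReal.ofReal_le_ofReal key).trans ?_
        rw [ENNReal.ofReal_mul (by positivity)]
        gcongr
        unfold bslH
        rcases le_or_gt (x - ν) 1 with ht | ht
        · rw [Set.indicator_of_mem (show x - ν ∈ Set.Ioc (0:ℝ) 1 from ⟨hxν0, ht⟩)]
          refine le_trans (ENNReal.ofReal_le_ofReal ?_) le_self_add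
          have : x ^ e ≤ 1 := Real.rpow_le_one_of_one_le_of_nonpos hx2 he0
          have h2 : 0 ≤ (x - ν)^(-β) := by positivity
          nlinarith
        · rw [Set.indicator_of_mem (show x - ν ∈ Set.Ioi (1:ℝ) from ht)]
          refine le_trans (ENNReal.ofReal_le_ofReal ?_) le_add_self
          have : x ^ e ≤ (x - ν)^e := Real.rpow_le_rpow_of_nonpos hxν0 (by linarith) he0
          rw [sub_eq_add_neg e β, Real.rpow_add hxν0]
          gcongr
    _ ≤ ∫⁻ x, ENNReal.ofReal (C ^ (q/2)) * bslH β e (x - ν) := setLIntegral_le_lintegral _ _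
    _ = ENNReal.ofReal (C ^ (q/2)) * ∫⁻ x, bslH β e (x - ν) :=
        lintegral_const_mul' _ _ ENNReal.ofReal_ne_top
    _ = _ := by rw [lintegral_sub_right_eq_self (fun t => bslH β e t)]

lemma bsl_reg2 {q α C : ℝ} (hq : 2 < q) (hα : α + 1 - q/3 ≤ 2/3) (hC0 : 0 < C)
    {ν τ : ℝ} (hτ : 1 ≤ τ) (hν : ν = τ^3)
    (hC : ∀ x : ℝ, 0 < x → x^2 ≤ ν^2 + 4 + 4 * τ^4 → |besselJ ν x| ≤ C / τ) :
    ∫⁻ x in Set.Ioc 1 (ν - τ/2), ENNReal.ofReal (x ^ α * |besselJ ν x| ^ q)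
      ≤ ENNReal.ofReal (C ^ q) := by
  have hτ0 : 0 < τ := by linarith
  have hν0 : 0 < ν := by rw [hν]; positivity
  have hC' : ∀ x : ℝ, 0 < x → x ≤ ν → |besselJ ν x| ≤ C / τ := fun x h1 h2 =>
    hC x h1 (by nlinarith [pow_pos hτ0 4])
  set D := max 1 (ν ^ (α+1)) * (C/τ)^(q-2) with hD
  have hD0 : 0 ≤ D := by positivity
  calc _ ≤ ∫⁻ x in Set.Ioc 1 (ν - τ/2), ENNReal.ofReal D * ENNReal.ofReal (besselJ ν x ^ 2 / x) := by
        refine setLIntegral_mono' measurableSet_Ioc fun x hx => ?_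
        rw [← ENNReal.ofReal_mul hD0]
        apply ENNReal.ofReal_le_ofReal
        have hx0 : 0 < x := by linarith [hx.1]
        have hxν : x ≤ ν := by linarith [hx.2]
        have h1 : x ^ α = x ^ (α+1) / x := by
          rw [Real.rpow_add_one hx0.ne']; field_simp
        have h2 : |besselJ ν x| ^ q = |besselJ ν x| ^ (q-2) * besselJ ν x ^ 2 := by
          rw [← sq_abs, ← Real.rpow_natCast, ← Real.rpow_add' (abs_nonneg _)]
          · congr 1; push_cast; ring
          · push_cast; linarith
        have h3 : x ^ (α+1) ≤ max 1 (ν ^ (α+1)) := by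
          rcases le_total 0 (α+1) with h | h
          · exact (Real.rpow_le_rpow hx0.le hxν h).trans (le_max_right _ _)
          · exact (Real.rpow_le_one_of_one_le_of_nonpos hx.1.le h).trans (le_max_left _ _)
        have h4 : |besselJ ν x| ^ (q-2) ≤ (C/τ)^(q-2) :=
          Real.rpow_le_rpow (abs_nonneg _) (hC' x hx0 hxν) (by linarith)
        rw [h1, h2, hD]
        calc _ = (x ^ (α+1) * |besselJ ν x| ^ (q-2)) * (besselJ ν x ^ 2 / x) := by ring
          _ ≤ _ := by gcongr
    _ = ENNReal.ofReal D * ∫⁻ x in Set.Ioc 1 (ν - τ/2), ENNReal.ofReal (besselJ ν x ^ 2 / x) :=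
        lintegral_const_mul' _ _ ENNReal.ofReal_ne_top
    _ ≤ ENNReal.ofReal D * ENNReal.ofReal ((C/τ)^2 / τ^2) := by
        gcongr
        exact bsl_low_int hτ hν hC'
    _ ≤ _ := by
        rw [← ENNReal.ofReal_mul hD0]
        apply ENNReal.ofReal_le_ofReal
        have e1 : D * ((C/τ)^2/τ^2) = C^q * (max 1 (ν ^ (α+1)) * τ ^ (-q-2)) := by
          have : (C/τ)^(q-2) * (C/τ)^2 = C^q / τ^q := by
            rw [← Real.div_rpow hC0.le hτ0.le, ← Real.rpow_natCast, ← Real.rpow_add (by positivity)]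
            congr 1; push_cast; ring
          have e2 : τ ^ (-q-2) = (τ^q)⁻¹ * (τ^2)⁻¹ := by
            rw [sub_eq_add_neg, Real.rpow_add hτ0, Real.rpow_neg hτ0.le, Real.rpow_neg hτ0.le]
            norm_num
          rw [hD, e2]
          calc _ = max 1 (ν ^ (α+1)) * ((C/τ)^(q-2) * (C/τ)^2) / τ^2 := by ring
            _ = _ := by rw [this]; ring
        rw [e1]
        have e3 : max 1 (ν ^ (α+1)) * τ ^ (-q-2) ≤ 1 := by
          have hp : 0 < τ ^ (-q-2) := by positivity
          rcases le_total 1 (ν ^ (α+1)) with h | h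
          · rw [max_eq_right h, hν, ← Real.rpow_natCast, ← Real.rpow_mul hτ0.le, ← Real.rpow_add hτ0]
            apply Real.rpow_le_one_of_one_le_of_nonpos hτ
            push_cast; linarith
          · rw [max_eq_left h, one_mul]
            apply Real.rpow_le_one_of_one_le_of_nonpos hτ
            linarith
        have : 0 ≤ C^q := by positivity
        nlinarith

lemma bsl_reg3 {q α C : ℝ} (hq : 2 < q) (hα : α + 1 - q/3 ≤ 2/3) (hC0 : 0 < C)
    {ν τ : ℝ} (hτ : 1 ≤ τ) (hν : ν = τ^3)
    (hC : ∀ x : ℝ, 0 < x → x^2 ≤ ν^2 + 4 + 4 * τ^4 → |besselJ ν x| ≤ C / τ) :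
    ∫⁻ x in Set.Ioc (ν - τ/2) (√(ν^2 + 4 + 4 * τ^4)), ENNReal.ofReal (x ^ α * |besselJ ν x| ^ q)
      ≤ ENNReal.ofReal (5 * 3 ^ |α| * C ^ q) := by
  have hτ0 : 0 < τ := by linarith
  have hν0 : 0 < ν := by rw [hν]; positivity
  have hτ2 : 1 ≤ τ^2 := one_le_pow₀ hτ
  have hτ4 : 1 ≤ τ^4 := one_le_pow₀ hτ
  have hντ : τ ≤ ν := by rw [hν]; nlinarith
  have hν1 : 1 ≤ ν := by linarith
  set r := √(ν^2 + 4 + 4 * τ^4) with hrdef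
  have hr2 : r^2 = ν^2 + 4 + 4 * τ^4 := Real.sq_sqrt (by positivity)
  have hr0 : 0 < r := Real.sqrt_pos.2 (by positivity)
  have hνr : ν < r := by nlinarith
  have hlen : r - ν ≤ 4 * τ := by
    have : (r - ν) * (2 * ν) ≤ 8 * τ^4 := by nlinarith
    rw [hν] at this ⊢
    have h3 : 0 < 2 * τ^3 := by positivity
    have : (r - τ^3) * (2*τ^3) ≤ (4 * τ) * (2*τ^3) := by linarith
    exact le_of_mul_le_mul_right this h3
  have hr3 : r ≤ 3 * ν := by
    have : τ^4 ≤ ν^2 := by rw [hν]; nlinarith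
    nlinarith
  calc _ ≤ ∫⁻ x in Set.Ioc (ν - τ/2) r, ENNReal.ofReal (3 ^ |α| * ν^α * (C/τ)^q) := by
        refine setLIntegral_mono' measurableSet_Ioc fun x hx => ENNReal.ofReal_le_ofReal ?_
        have hx1 : ν/2 ≤ x := by linarith [hx.1]
        have hx0 : 0 < x := by linarith
        have h1 : x^α ≤ 3 ^ |α| * ν^α := by
          have : x^α = (x/ν)^α * ν^α := by
            rw [← Real.mul_rpow (by positivity) hν0.le]; congr 1; field_simp
          rw [this]
          gcongr
          apply bsl_rpow_bd
          · rw [le_div_iff₀ hν0]; linarith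
          · rw [div_le_iff₀ hν0]; linarith [hx.2]
        have h2 := hC x hx0 (by rw [← hr2]; exact pow_le_pow_left₀ hx0.le hx.2 2)
        gcongr
    _ = ENNReal.ofReal (3 ^ |α| * ν^α * (C/τ)^q * (r - (ν - τ/2))) := by
        rw [setLIntegral_const, Real.volume_Ioc, ← ENNReal.ofReal_mul (by positivity)]
    _ ≤ _ := by
        apply ENNReal.ofReal_le_ofReal
        calc _ ≤ 3 ^ |α| * ν^α * (C/τ)^q * (5 * τ) := by gcongr; linarith
          _ = 5 * 3 ^ |α| * C^q * τ ^ (3*α - q + 1) := by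
            rw [Real.div_rpow hC0.le hτ0.le, hν, ← Real.rpow_natCast, ← Real.rpow_mul hτ0.le,
              Real.rpow_add_one hτ0.ne', Real.rpow_sub hτ0]
            push_cast; ring
          _ ≤ 5 * 3 ^ |α| * C^q * 1 := by
            gcongr
            apply Real.rpow_le_one_of_one_le_of_nonpos hτ
            linarith
          _ = _ := mul_one _

lemma bsl_reg5 {q α : ℝ} (hq : 2 < q) {ν : ℝ} (h0 : 0 ≤ ν) (h1 : ν ≤ 1) :
    ∫⁻ x in Set.Ioc 1 3, ENNReal.ofReal (x ^ α * |besselJ ν x| ^ q)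
      ≤ ENNReal.ofReal (2 * (3 ^ |α| * (2 * Real.exp (9/4) * (3/2)) ^ q)) := by
  calc _ ≤ ∫⁻ x in Set.Ioc (1:ℝ) 3, ENNReal.ofReal (3 ^ |α| * (2 * Real.exp (9/4) * (3/2)) ^ q) := by
        refine setLIntegral_mono' measurableSet_Ioc fun x hx => ENNReal.ofReal_le_ofReal ?_
        have hx0 : 0 < x := by linarith [hx.1]
        have a1 : |besselJ ν x| ≤ 2 * Real.exp (9/4) * (3/2) := by
          refine (besselJ_crude h0 hx0).trans ?_
          have : (x/2)^ν ≤ 3/2 := by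
            calc (x/2)^ν ≤ (3/2)^ν := Real.rpow_le_rpow (by positivity) (by linarith [hx.2]) h0
              _ ≤ (3/2)^(1:ℝ) := Real.rpow_le_rpow_of_exponent_le (by norm_num) h1
              _ = _ := by norm_num
          gcongr
          nlinarith [hx.1, hx.2]
        have a2 : x^α ≤ 3 ^ |α| := bsl_rpow_bd (by linarith [hx.1]) hx.2
        gcongr
    _ = _ := by
        rw [setLIntegral_const, Real.volume_Ioc, mul_comm, ← ENNReal.ofReal_mul (by norm_num)]
        norm_num

/-- uniform bound -/
lemma bsl_uniform {n : ℕ} (hn : 2 ≤ n) {q : ℝ} (hq : 2 * n / ((n : ℝ) - 1) < q) :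
    ∃ K : ℝ, 0 < K ∧ ∀ ν : ℝ, ((n:ℝ)-2)/2 ≤ ν →
    ∫⁻ x in Set.Ioi 0, ENNReal.ofReal
      (x ^ (-(q * ((n : ℝ) - 2)) / 2 + (n : ℝ) - 1) * |besselJ ν x| ^ q) ≤ ENNReal.ofReal K := by
  have hn' : (2:ℝ) ≤ n := by exact_mod_cast hn
  have hqn : 2 * n < q * ((n:ℝ)-1) := (div_lt_iff₀ (by linarith)).1 hq
  have hq2 : 2 < q := by nlinarith
  set α := -(q * ((n : ℝ) - 2)) / 2 + (n : ℝ) - 1 with hα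
  obtain ⟨β, hβ0, hβ1, hβq, hβ⟩ : ∃ β : ℝ, 0 ≤ β ∧ β < 1 ∧ β ≤ q/4 ∧ α - q/3 + 1 < 2*β/3 := by
    rcases lt_or_ge q 4 with h4 | h4
    · exact ⟨q/4, by linarith, by linarith, le_rfl, by rw [hα]; nlinarith⟩
    · have hlt : α - q/3 + 1 < 2/3 := by
        rw [hα]
        rcases eq_or_lt_of_le hn with h | h
        · have : (n:ℝ) = 2 := by exact_mod_cast h.symm
          rw [this] at hqn ⊢
          linarith
        · have : (3:ℝ) ≤ n := by exact_mod_cast h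
          nlinarith
      obtain ⟨β, h1, h2⟩ := exists_between (show max 0 (3/2*(α - q/3+1)) < 1 by
        apply max_lt <;> linarith)
      have := le_max_left 0 (3/2*(α - q/3+1))
      have := le_max_right 0 (3/2*(α - q/3+1))
      exact ⟨β, by linarith, h2, by linarith, by linarith⟩
  set e := α - q/3 + β/3 with he
  obtain ⟨C1, hC1, h1⟩ := bsl_region_J
  obtain ⟨C2, hC2, h2⟩ := bsl_low
  have hH := bslH_fin (β := β) (e := e) hβ1 (by linarith)
  set A1 := (2 * Real.exp 1) ^ q
  set A2 := C2 ^ q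
  set A3 := 5 * 3 ^ |α| * C2 ^ q
  set A4 := C1 ^ (q/2) * (∫⁻ t, bslH β e t).toReal
  set A5 := 2 * (3 ^ |α| * (2 * Real.exp (9/4) * (3/2)) ^ q)
  have p1 : 0 < A1 := by positivity
  have p2 : 0 < A2 := by positivity
  have p3 : 0 < A3 := by positivity
  have p4 : 0 ≤ A4 := by positivity
  have p5 : 0 < A5 := by positivity
  refine ⟨A1 + A2 + A3 + A4 + A5, by positivity, fun ν hν => ?_⟩
  have hν0 : 0 ≤ ν := by linarith
  set τ := ν ^ ((1:ℝ)/3)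
  have hτ : 0 ≤ τ := Real.rpow_nonneg hν0 _
  have hτ3 : ν = τ^3 := by
    simp only [τ]
    rw [← Real.rpow_natCast, ← Real.rpow_mul hν0]; norm_num
  have r1 := bsl_reg1 hn hq2 hν
  have r4 := bsl_reg4 hβ0 hβq he (by linarith) (by linarith) h1 hC1 hτ hτ3
  have e4 : ENNReal.ofReal (C1 ^ (q/2)) * ∫⁻ t, bslH β e t = ENNReal.ofReal A4 := by
    simp only [A4]
    rw [ENNReal.ofReal_mul (by positivity), ENNReal.ofReal_toReal hH.ne]
  rw [e4] at r4
  rcases le_total 1 τ with ht | ht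
  · have r2 := bsl_reg2 hq2 (by linarith : α + 1 - q/3 ≤ 2/3) hC2 ht hτ3
      (fun x => h2 ν τ x ht hτ3)
    have r3 := bsl_reg3 hq2 (by linarith : α + 1 - q/3 ≤ 2/3) hC2 ht hτ3
      (fun x => h2 ν τ x ht hτ3)
    have hsub : Set.Ioi (0:ℝ) ⊆ ((Set.Ioc 0 1 ∪ Set.Ioc 1 (ν - τ/2)) ∪
        Set.Ioc (ν - τ/2) (√(ν^2 + 4 + 4 * τ^4))) ∪ {x : ℝ | 0 < x ∧ ν^2 + 4 + 4 * τ^4 ≤ x^2} := by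
      intro x hx
      have hx : 0 < x := hx
      by_cases a1 : x ≤ 1
      · exact Or.inl (Or.inl (Or.inl ⟨hx, a1⟩))
      by_cases a2 : x ≤ ν - τ/2
      · exact Or.inl (Or.inl (Or.inr ⟨not_le.1 a1, a2⟩))
      by_cases a3 : x ≤ √(ν^2 + 4 + 4 * τ^4)
      · exact Or.inl (Or.inr ⟨not_le.1 a2, a3⟩)
      · exact Or.inr ⟨hx, ((Real.sqrt_lt' hx).1 (not_le.1 a3)).le⟩
    refine (lintegral_mono_set hsub).trans ?_
    refine (lintegral_union_le _ _ _).trans ?_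
    refine (add_le_add ((lintegral_union_le _ _ _).trans
      (add_le_add ((lintegral_union_le _ _ _).trans (add_le_add r1 r2)) r3)) r4).trans ?_
    rw [← ENNReal.ofReal_add p1.le p2.le, ← ENNReal.ofReal_add (by positivity) p3.le,
      ← ENNReal.ofReal_add (by positivity) p4]
    apply ENNReal.ofReal_le_ofReal
    linarith
  · have hν1 : ν ≤ 1 := by rw [hτ3]; exact pow_le_one₀ hτ ht
    have hτ4 : τ^4 ≤ 1 := pow_le_one₀ hτ ht
    have r5 := bsl_reg5 (α := α) hq2 hν0 hν1
    have hsub : Set.Ioi (0:ℝ) ⊆ ((Set.Ioc 0 1 ∪ Set.Ioc 1 3) ∪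
        {x : ℝ | 0 < x ∧ ν^2 + 4 + 4 * τ^4 ≤ x^2}) := by
      intro x hx
      have hx : 0 < x := hx
      by_cases a1 : x ≤ 1
      · exact Or.inl (Or.inl ⟨hx, a1⟩)
      by_cases a2 : x ≤ 3
      · exact Or.inl (Or.inr ⟨not_le.1 a1, a2⟩)
      · refine Or.inr ⟨hx, ?_⟩
        push Not at a2
        nlinarith
    refine (lintegral_mono_set hsub).trans ?_
    refine (lintegral_union_le _ _ _).trans ?_
    refine (add_le_add ((lintegral_union_le _ _ _).trans (add_le_add r1 r5)) r4).trans ?_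
    rw [← ENNReal.ofReal_add p1.le p5.le, ← ENNReal.ofReal_add (by positivity) p4]
    apply ENNReal.ofReal_le_ofReal
    linarith


lemma bsl_mink {X : Type*} [MeasurableSpace X] (κ : Measure X) [SFinite κ] (μ : Measure ℝ)
    [SFinite μ] (Ψ : ℝ → X → ENNReal) (hΨ : Measurable (Function.uncurry Ψ)) {p : ℝ} (hp : 1 < p)
    (K : ENNReal) (hK : ∀ x, ∫⁻ ρ, Ψ ρ x ^ p ∂μ ≤ K) :
    ∫⁻ ρ, (∫⁻ x, Ψ ρ x ∂κ) ^ p ∂μ ≤ K * κ Set.univ ^ p := by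
  have hpq := Real.HolderConjugate.conjExponent hp
  have hp0 : 0 < p := by linarith
  have h1 : ∀ ρ, (∫⁻ x, Ψ ρ x ∂κ) ^ p ≤ (∫⁻ x, Ψ ρ x ^ p ∂κ) * κ Set.univ ^ (p - 1) := by
    intro ρ
    have hm : Measurable (Ψ ρ) := hΨ.of_uncurry_left
    have h := ENNReal.lintegral_mul_le_Lp_mul_Lq κ hpq (f := Ψ ρ) (g := fun _ => 1)
      hm.aemeasurable aemeasurable_const
    simp only [Pi.mul_apply, mul_one, ENNReal.one_rpow, lintegral_const, one_mul] at h
    refine (ENNReal.rpow_le_rpow h hp0.le).trans ?_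
    rw [ENNReal.mul_rpow_of_nonneg _ _ hp0.le, ← ENNReal.rpow_mul, ← ENNReal.rpow_mul]
    have e1 : 1 / p * p = 1 := by field_simp
    have e2 : 1 / p.conjExponent * p = p - 1 := by
      unfold Real.conjExponent
      have : p - 1 ≠ 0 := by linarith
      field_simp
    rw [e1, e2, ENNReal.rpow_one]
  refine (lintegral_mono h1).trans ?_
  have hm2 : Measurable (Function.uncurry fun ρ x => Ψ ρ x ^ p) := hΨ.pow_const p
  rw [lintegral_mul_const _ hm2.lintegral_prod_right, lintegral_lintegral_swap hm2.aemeasurable]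
  have h2 : ∫⁻ x, ∫⁻ ρ, Ψ ρ x ^ p ∂μ ∂κ ≤ K * κ Set.univ := by
    refine (lintegral_mono hK).trans ?_
    simp
  refine (mul_le_mul_left h2 _).trans ?_
  rw [mul_assoc]
  conv_lhs => enter [2, 1]; rw [← ENNReal.rpow_one (κ Set.univ)]
  rw [← ENNReal.rpow_add_of_nonneg _ _ zero_le_one (by linarith)]
  simp

lemma bsl_Jt_meas {ν : ℝ} (hν : 0 ≤ ν) : Measurable ((Set.Ioi (0:ℝ)).indicator (besselJ ν)) := by
  have hc : ContinuousOn (besselJ ν) (Set.Ioi 0) := fun x hx =>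
    (besselJ_deriv' hν hx).continuousAt.continuousWithinAt
  rw [← Set.piecewise_eq_indicator]
  exact hc.measurable_piecewise continuousOn_const measurableSet_Ioi

lemma bsl_ind_meas {a b : ℝ} {f : ℝ → ℝ} (hf : ContinuousOn f (Set.Ioo a b)) :
    Measurable ((Set.Ioo a b).indicator f) := by
  rw [← Set.piecewise_eq_indicator]
  exact hf.measurable_piecewise continuousOn_const measurableSet_Ioo

lemma bsl_scale (H : ℝ → ENNReal) {G : ℝ} (hG : 0 < G) :
    ∫⁻ ρ in Set.Ioi (0:ℝ), H (ρ * G) = ENNReal.ofReal G⁻¹ * ∫⁻ x in Set.Ioi (0:ℝ), H x := by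
  rw [← lintegral_indicator measurableSet_Ioi, ← lintegral_indicator measurableSet_Ioi]
  have h1 : ∀ ρ, (Set.Ioi (0:ℝ)).indicator (fun ρ => H (ρ * G)) ρ
      = (Set.Ioi (0:ℝ)).indicator H (ρ * G) := by
    intro ρ
    simp only [Set.indicator, Set.mem_Ioi, mul_pos_iff_of_pos_right hG]
  simp_rw [h1]
  have e := (Homeomorph.mulRight₀ G hG.ne').measurableEmbedding
  have h2 := e.lintegral_map (μ := volume) ((Set.Ioi (0:ℝ)).indicator H)
  have h3 : Measure.map (Homeomorph.mulRight₀ G hG.ne') (volume : Measure ℝ)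
    = ENNReal.ofReal |G⁻¹| • volume := Real.map_volume_mul_right hG.ne'
  rw [h3, lintegral_smul_measure, abs_of_pos (inv_pos.2 hG)] at h2
  simpa using h2.symm

lemma bsl_psi_bound {α q K ν G w : ℝ} (hq : 0 < q) (hG : 0 < G) (hw : 0 ≤ w)
    (hK : ∫⁻ x in Set.Ioi 0, ENNReal.ofReal (x ^ α * |besselJ ν x| ^ q) ≤ ENNReal.ofReal K) :
    ∫⁻ ρ in Set.Ioi (0:ℝ), ENNReal.ofReal (ρ ^ α) *
      ENNReal.ofReal (G * w * ((Set.Ioi (0:ℝ)).indicator (besselJ ν) (ρ * G)) ^ 2) ^ (q / 2)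
    ≤ ENNReal.ofReal (G ^ (q / 2 - α - 1) * w ^ (q / 2) * K) := by
  have h1 : ∀ ρ ∈ Set.Ioi (0:ℝ), ENNReal.ofReal (ρ ^ α) *
      ENNReal.ofReal (G * w * ((Set.Ioi (0:ℝ)).indicator (besselJ ν) (ρ * G)) ^ 2) ^ (q / 2)
      = ENNReal.ofReal (G ^ (q / 2 - α) * w ^ (q / 2)) *
        ENNReal.ofReal ((ρ * G) ^ α * |besselJ ν (ρ * G)| ^ q) := by
    intro ρ hρ
    have hρ' : 0 < ρ := hρ
    have hm : ρ * G ∈ Set.Ioi (0:ℝ) := mul_pos hρ' hG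
    rw [Set.indicator_of_mem hm, ENNReal.ofReal_rpow_of_nonneg (by positivity) (by positivity),
      ← ENNReal.ofReal_mul (by positivity), ← ENNReal.ofReal_mul (by positivity)]
    congr 1
    rw [Real.mul_rpow (by positivity) (by positivity), Real.mul_rpow hG.le hw,
      Real.mul_rpow hρ'.le hG.le, Real.rpow_sub hG, ← sq_abs (besselJ ν (ρ * G)),
      ← Real.rpow_natCast |besselJ ν (ρ * G)| 2, ← Real.rpow_mul (abs_nonneg _)]
    have e : ((2:ℕ):ℝ) * (q / 2) = q := by push_cast; ring
    rw [e]
    have := (Real.rpow_pos_of_pos hG α).ne'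
    field_simp
  rw [setLIntegral_congr_fun measurableSet_Ioi h1, lintegral_const_mul' _ _ ENNReal.ofReal_ne_top,
    bsl_scale (fun x => ENNReal.ofReal (x ^ α * |besselJ ν x| ^ q)) hG]
  refine (mul_le_mul_right (mul_le_mul_right hK _) _).trans ?_
  rw [← ENNReal.ofReal_mul (by positivity), ← ENNReal.ofReal_mul (by positivity)]
  apply ENNReal.ofReal_le_ofReal
  rw [Real.rpow_sub hG (q / 2 - α), Real.rpow_one]
  apply le_of_eq; field_simp

lemma bsl_ofReal_integral_le {X : Type*} [MeasurableSpace X] (μ : Measure X) (f : X → ℝ)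
    (hf : 0 ≤ᵐ[μ] f) : ENNReal.ofReal (∫ x, f x ∂μ) ≤ ∫⁻ x, ENNReal.ofReal (f x) ∂μ := by
  by_cases h : Integrable f μ
  · rw [ofReal_integral_eq_lintegral_ofReal h hf]
  · rw [integral_undef h]; simp

/-- **Key Bessel-series lemma for restriction to surfaces of revolution (weighted form).**
Let `n ≥ 2` and let `g` be continuous on `I = [a,b]`, positive on `(a,b)`, `C¹` on `(a,b)`
with bounded derivative, and `0` outside `I`. For `q > 2n/(n-1)` there is a constant `C`
such that for all indices `ν j ≥ (n-2)/2` and Schwartz functions `a j` (all but finitely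
many zero),
`∫_0^∞ ρ^{-q(n-2)/2+n-1} (∑_j ∫ |g|ⁿ (1+g'²) |a_j|² |J_{ν_j}(ρ g)|² dz)^{q/2} dρ
  ≤ C (∑_j ∫ |g|^{n-1} (1+g'²)^{1/2} |a_j|² dz)^{q/2}`. -/
theorem bessel_series_restriction_weighted
    (n : ℕ) (hn : 2 ≤ n) (a b : ℝ) (hab : a < b) (g g' : ℝ → ℝ)
    (hgc : ContinuousOn g (Set.Icc a b))
    (hgpos : ∀ z ∈ Set.Ioo a b, 0 < g z)
    (hgd : ∀ z ∈ Set.Ioo a b, HasDerivAt g (g' z) z)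
    (hg'c : ContinuousOn g' (Set.Ioo a b))
    (B : ℝ) (hB : ∀ z ∈ Set.Ioo a b, |g' z| ≤ B)
    (hgext : ∀ z ∉ Set.Icc a b, g z = 0)
    (q : ℝ) (hq : 2 * n / ((n : ℝ) - 1) < q) :
    ∃ C : ℝ, 0 < C ∧
      ∀ (ν : ℕ → ℝ), (∀ j, ((n : ℝ) - 2) / 2 ≤ ν j) →
      ∀ (A : ℕ → SchwartzMap ℝ ℂ), {j | A j ≠ 0}.Finite →
        (∫ ρ in Set.Ioi (0 : ℝ),
            ρ ^ (-(q * ((n : ℝ) - 2)) / 2 + (n : ℝ) - 1) *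
              (∑' j : ℕ, ∫ z : ℝ,
                  |g z| ^ n * (1 + g' z ^ 2) * ‖A j z‖ ^ 2 *
                    besselJ (ν j) (ρ * g z) ^ 2) ^ (q / 2))
        ≤ C * (∑' j : ℕ, ∫ z : ℝ,
            |g z| ^ (n - 1) * Real.sqrt (1 + g' z ^ 2) * ‖A j z‖ ^ 2) ^ (q / 2) := by
  obtain ⟨K, hK0, hK⟩ := bsl_uniform hn hq
  obtain ⟨G1, hG1⟩ := isCompact_Icc.exists_bound_of_continuousOn hgc
  have hn2 : (2:ℝ) ≤ n := by exact_mod_cast hn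
  have hn1 : (0:ℝ) < (n:ℝ) - 1 := by linarith
  have hqn : 2 * (n:ℝ) < q * ((n:ℝ) - 1) := (div_lt_iff₀ hn1).1 hq
  have hq2 : 2 < q := by nlinarith
  set α : ℝ := -(q * ((n : ℝ) - 2)) / 2 + (n : ℝ) - 1 with hα
  have hδ : 0 < q / 2 - α - 1 := by rw [hα]; nlinarith
  set G0 : ℝ := max G1 1 with hG0
  have hG0p : 0 < G0 := lt_of_lt_of_le one_pos (le_max_right _ _)
  have hgG : ∀ z ∈ Set.Ioo a b, g z ≤ G0 := fun z hz =>
    ((le_abs_self _).trans (hG1 z (Set.Ioo_subset_Icc_self hz))).trans (le_max_left _ _)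
  set W : ℝ := √(1 + B ^ 2) with hW
  have hWp : 0 < W := Real.sqrt_pos.2 (by positivity)
  set w : ℝ → ℝ := fun z => √(1 + g' z ^ 2) with hw
  have hwp : ∀ z, 0 < w z := fun z => Real.sqrt_pos.2 (by positivity)
  have hwW : ∀ z ∈ Set.Ioo a b, w z ≤ W := fun z hz => Real.sqrt_le_sqrt (by
    have := hB z hz
    have h2 : g' z ^ 2 ≤ B ^ 2 := by
      rw [← sq_abs]; exact pow_le_pow_left₀ (abs_nonneg _) this 2
    linarith)
  have hww : ∀ z, w z * w z = 1 + g' z ^ 2 := fun z => Real.mul_self_sqrt (by positivity)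
  have hwc : ContinuousOn w (Set.Ioo a b) := (continuousOn_const.add (hg'c.pow 2)).sqrt
  set gt := (Set.Ioo a b).indicator g with hgt
  set wt := (Set.Ioo a b).indicator w with hwt
  have hgtm : Measurable gt := bsl_ind_meas (hgc.mono Set.Ioo_subset_Icc_self)
  have hwtm : Measurable wt := bsl_ind_meas hwc
  have hae : ∀ᵐ z : ℝ, z ≠ a ∧ z ≠ b := by
    have h1 : ∀ᵐ z : ℝ, z ≠ a := by simp [ae_iff]
    have h2 : ∀ᵐ z : ℝ, z ≠ b := by simp [ae_iff]
    exact h1.and h2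
  have hout : ∀ z, z ≠ a → z ≠ b → z ∉ Set.Ioo a b → g z = 0 := by
    intro z h1 h2 h3
    apply hgext
    intro h4
    exact h3 ⟨lt_of_le_of_ne h4.1 h1.symm, lt_of_le_of_ne h4.2 h2⟩
  set K' : ℝ := G0 ^ (q / 2 - α - 1) * W ^ (q / 2) * K with hK'
  have hK'p : 0 < K' := by positivity
  refine ⟨K', hK'p, ?_⟩
  intro ν hν A hA
  have hν0 : ∀ j, 0 ≤ ν j := fun j => le_trans (by linarith) (hν j)
  set M : ℕ → ℝ → ℝ := fun j z => gt z ^ (n - 1) * wt z * ‖A j z‖ ^ 2 with hM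
  have hgt0 : ∀ z, 0 ≤ gt z := fun z => Set.indicator_nonneg (fun z hz => (hgpos z hz).le) z
  have hwt0 : ∀ z, 0 ≤ wt z := fun z => Set.indicator_nonneg (fun z _ => (hwp z).le) z
  have hM0 : ∀ j z, 0 ≤ M j z := fun j z =>
    mul_nonneg (mul_nonneg (pow_nonneg (hgt0 z) _) (hwt0 z)) (by positivity)
  have hMm : ∀ j, Measurable (M j) := fun j =>
    ((hgtm.pow_const _).mul hwtm).mul ((A j).continuous.measurable.norm.pow_const 2)
  have hMi : ∀ j, Integrable (M j) := by
    intro j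
    obtain ⟨c, hc⟩ := isCompact_Icc.exists_bound_of_continuousOn
      ((A j).continuous.continuousOn (s := Set.Icc a b))
    have h1 : IntegrableOn (M j) (Set.Ioo a b) := by
      refine Measure.integrableOn_of_bounded (M := G0 ^ (n - 1) * W * c ^ 2) (by simp)
        (hMm j).aestronglyMeasurable ?_
      rw [ae_restrict_iff' measurableSet_Ioo]
      refine Filter.Eventually.of_forall fun z hz => ?_
      rw [Real.norm_of_nonneg (hM0 j z)]
      have e1 : gt z = g z := Set.indicator_of_mem hz g
      have e2 : wt z = w z := Set.indicator_of_mem hz w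
      simp only [hM, e1, e2]
      have := hc z (Set.Ioo_subset_Icc_self hz)
      have := hgG z hz
      have := hwW z hz
      have := (hgpos z hz).le
      have := (hwp z).le
      gcongr
    refine h1.integrable_of_forall_notMem_eq_zero fun z hz => ?_
    have e2 : wt z = 0 := Set.indicator_of_notMem hz w
    simp [hM, e2]
  set Jt : ℝ → ℝ → ℝ := fun μ => (Set.Ioi (0:ℝ)).indicator (besselJ μ) with hJt
  set Ψ : ℝ → ℕ × ℝ → ENNReal := fun ρ x =>
    ENNReal.ofReal (gt x.2 * wt x.2 * (Jt (ν x.1) (ρ * gt x.2)) ^ 2) with hΨ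
  have hΨm : Measurable (Function.uncurry Ψ) := by
    have h1 : Measurable (fun y : ℕ × (ℝ × ℝ) => Jt (ν y.1) (y.2.1 * gt y.2.2)) := by
      apply measurable_from_prod_countable_right
      intro j
      exact (bsl_Jt_meas (hν0 j)).comp (measurable_fst.mul (hgtm.comp measurable_snd))
    have h2 : Measurable (fun y : ℝ × (ℕ × ℝ) => ((y.2.1, (y.1, y.2.2)) : ℕ × (ℝ × ℝ))) := by
      fun_prop
    have h3 := h1.comp h2
    have h4 : Measurable (fun y : ℝ × (ℕ × ℝ) => y.2.2) := by fun_prop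
    exact (((hgtm.comp h4).mul (hwtm.comp h4)).mul (h3.pow_const 2)).ennreal_ofReal
  set m : ℕ × ℝ → ENNReal := fun x => ENNReal.ofReal (M x.1 x.2) with hm
  have hmm : Measurable m := by
    apply measurable_from_prod_countable_right
    intro j
    exact (hMm j).ennreal_ofReal
  set κ : Measure (ℕ × ℝ) := (Measure.count.prod volume).withDensity m with hκ
  set μ : Measure ℝ := (volume.restrict (Set.Ioi (0:ℝ))).withDensity
    (fun ρ => ENNReal.ofReal (ρ ^ α)) with hμ
  have hρm : Measurable (fun ρ : ℝ => ENNReal.ofReal (ρ ^ α)) :=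
    (measurable_id.pow_const α).ennreal_ofReal
  have hbound : ∀ x, ∫⁻ ρ, Ψ ρ x ^ (q / 2) ∂μ ≤ ENNReal.ofReal K' := by
    rintro ⟨j, z⟩
    have hpm : Measurable (fun ρ => Ψ ρ (j, z) ^ (q / 2)) :=
      (hΨm.of_uncurry_right).pow_const _
    rw [hμ, lintegral_withDensity_eq_lintegral_mul _ hρm hpm]
    by_cases hz : z ∈ Set.Ioo a b
    · have e1 : gt z = g z := Set.indicator_of_mem hz g
      have e2 : wt z = w z := Set.indicator_of_mem hz w
      have h := bsl_psi_bound (w := w z) (by linarith : 0 < q) (hgpos z hz) (hwp z).le (hK (ν j) (hν j))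
      simp only [Pi.mul_apply, hΨ, e1, e2, hJt]
      refine h.trans (ENNReal.ofReal_le_ofReal ?_)
      have := hgG z hz
      have := hwW z hz
      have := (hgpos z hz).le
      have := (hwp z).le
      rw [hK']
      gcongr
    · have e2 : wt z = 0 := Set.indicator_of_notMem hz w
      simp [hΨ, e2, ENNReal.zero_rpow_of_pos (by linarith : 0 < q / 2)]
  have main := bsl_mink κ μ Ψ hΨm (by linarith : 1 < q / 2) _ hbound
  have hκint : ∀ f : ℕ × ℝ → ENNReal, Measurable f →
      ∫⁻ x, f x ∂κ = ∑' j, ∫⁻ z, ENNReal.ofReal (M j z) * f (j, z) := by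
    intro f hf
    rw [hκ, lintegral_withDensity_eq_lintegral_mul _ hmm hf,
      lintegral_prod _ (hmm.mul hf).aemeasurable, lintegral_count]
    rfl
  set F := hA.toFinset with hF
  have hAF : ∀ j, j ∉ F → A j = 0 := by
    intro j hj
    by_contra h
    exact hj (hA.mem_toFinset.2 h)
  set T : ℝ := ∑' j : ℕ, ∫ z : ℝ,
            |g z| ^ (n - 1) * Real.sqrt (1 + g' z ^ 2) * ‖A j z‖ ^ 2 with hT
  have hMeq : ∀ j, (∫ z : ℝ, |g z| ^ (n - 1) * Real.sqrt (1 + g' z ^ 2) * ‖A j z‖ ^ 2)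
      = ∫ z, M j z := by
    intro j
    apply integral_congr_ae
    filter_upwards [hae] with z hz
    by_cases hzm : z ∈ Set.Ioo a b
    · have e1 : gt z = g z := Set.indicator_of_mem hzm g
      have e2 : wt z = w z := Set.indicator_of_mem hzm w
      simp only [hM, e1, e2, abs_of_pos (hgpos z hzm), hw]
    · have e2 : wt z = 0 := Set.indicator_of_notMem hzm w
      have e3 := hout z hz.1 hz.2 hzm
      have e4 : n - 1 ≠ 0 := by omega
      simp [hM, e2, e3, e4]
  have hT0 : 0 ≤ T := tsum_nonneg fun j => by
    rw [hMeq j]; exact integral_nonneg (hM0 j)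
  have hκu : κ Set.univ = ENNReal.ofReal T := by
    have h1 := hκint (fun _ => 1) measurable_const
    simp only [lintegral_const, one_mul, mul_one] at h1
    rw [h1, hT, tsum_eq_sum (s := F), tsum_eq_sum (s := F), ENNReal.ofReal_sum_of_nonneg]
    · refine Finset.sum_congr rfl fun j _ => ?_
      rw [hMeq, ofReal_integral_eq_lintegral_ofReal (hMi j) (Filter.Eventually.of_forall (hM0 j))]
    · intro j _
      rw [hMeq j]; exact integral_nonneg (hM0 j)
    · intro j hj
      simp [hAF j hj]
    · intro j hj
      simp [hM, hAF j hj]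
  set S : ℝ → ℝ := fun ρ => ∑' j : ℕ, ∫ z : ℝ,
                  |g z| ^ n * (1 + g' z ^ 2) * ‖A j z‖ ^ 2 *
                    besselJ (ν j) (ρ * g z) ^ 2 with hS
  have hI0 : ∀ ρ j z, 0 ≤ |g z| ^ n * (1 + g' z ^ 2) * ‖A j z‖ ^ 2 *
                    besselJ (ν j) (ρ * g z) ^ 2 := fun ρ j z => by positivity
  have hS0 : ∀ ρ, 0 ≤ S ρ := fun ρ => tsum_nonneg fun j => integral_nonneg (hI0 ρ j)
  have hSle : ∀ ρ ∈ Set.Ioi (0:ℝ), ENNReal.ofReal (S ρ) ≤ ∫⁻ x, Ψ ρ x ∂κ := by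
    intro ρ hρ
    rw [hκint _ hΨm.of_uncurry_left]
    simp only [hS]
    rw [tsum_eq_sum (s := F) (fun j hj => by simp [hAF j hj]),
      ENNReal.ofReal_sum_of_nonneg (fun j _ => integral_nonneg (hI0 ρ j))]
    refine le_trans (Finset.sum_le_sum fun j _ => ?_) (ENNReal.sum_le_tsum F)
    refine (bsl_ofReal_integral_le _ _ (Filter.Eventually.of_forall (hI0 ρ j))).trans ?_
    apply le_of_eq
    apply lintegral_congr_ae
    filter_upwards [hae] with z hz
    by_cases hzm : z ∈ Set.Ioo a b
    · have e1 : gt z = g z := Set.indicator_of_mem hzm g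
      have e2 : wt z = w z := Set.indicator_of_mem hzm w
      have e3 : Jt (ν j) (ρ * g z) = besselJ (ν j) (ρ * g z) :=
        Set.indicator_of_mem (show ρ * g z ∈ Set.Ioi (0:ℝ) from mul_pos hρ (hgpos z hzm)) _
      simp only [hΨ]
      rw [← ENNReal.ofReal_mul (hM0 j z)]
      simp only [hM, e1, e2, e3, abs_of_pos (hgpos z hzm)]
      congr 1
      rw [← hww z]
      obtain ⟨k, rfl⟩ : ∃ k, n = k + 1 := ⟨n - 1, by omega⟩
      simp only [Nat.add_sub_cancel]
      ring
    · have e2 : wt z = 0 := Set.indicator_of_notMem hzm w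
      have e3 := hout z hz.1 hz.2 hzm
      have e4 : n ≠ 0 := by omega
      simp [hΨ, e2, e3, e4]
  have hfin : ENNReal.ofReal (∫ ρ in Set.Ioi (0 : ℝ), ρ ^ α * S ρ ^ (q / 2))
      ≤ ENNReal.ofReal (K' * T ^ (q / 2)) := by
    refine (bsl_ofReal_integral_le _ _ ?_).trans ?_
    · filter_upwards [ae_restrict_mem measurableSet_Ioi] with ρ hρ
      exact mul_nonneg (Real.rpow_nonneg (le_of_lt hρ) _) (Real.rpow_nonneg (hS0 ρ) _)
    · rw [ENNReal.ofReal_mul hK'p.le, ← ENNReal.ofReal_rpow_of_nonneg hT0 (by linarith), ← hκu]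
      refine le_trans ?_ main
      have hpm : Measurable (fun ρ => (∫⁻ x, Ψ ρ x ∂κ) ^ (q / 2)) :=
        (hΨm.lintegral_prod_right).pow_const _
      rw [hμ, lintegral_withDensity_eq_lintegral_mul _ hρm hpm]
      refine setLIntegral_mono' measurableSet_Ioi fun ρ hρ => ?_
      rw [ENNReal.ofReal_mul (Real.rpow_nonneg (le_of_lt hρ) _),
        ← ENNReal.ofReal_rpow_of_nonneg (hS0 ρ) (by linarith)]
      simp only [Pi.mul_apply]
      gcongr
      exact hSle ρ hρ
  exact (ENNReal.ofReal_le_ofReal_iff (by positivity)).1 hfin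
end

section
/- There is a constant C such that for every real ν ≥ 1 and every real ρ with 0 < ρ ≤ (3/2) ν^{2/3}, one has |J_ν( ν + ρ ν^{1/3} )| ≤ C / ( ρ^{1/4} ν^{1/3} ). -/
open Real

open Filter Topology

noncomputable def bc (ν : ℝ) (m : ℕ) : ℝ := (-1 : ℝ) ^ m / (m.factorial * Real.Gamma (m + ν + 1))
noncomputable def bterm (ν : ℝ) (k m : ℕ) (t : ℝ) : ℝ :=
  bc ν m * (2 * m + ν) ^ k * exp ((2 * m + ν) * (t - log 2))
noncomputable def bfun (ν : ℝ) (k : ℕ) (t : ℝ) : ℝ := ∑' m, bterm ν k m t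
noncomputable def bbound (ν : ℝ) (k : ℕ) (T : ℝ) (m : ℕ) : ℝ :=
  k.factorial * exp (ν * (T - log 2 + 1)) * ((exp (2 * (T - log 2 + 1))) ^ m / m.factorial)

lemma bbound_summable (ν : ℝ) (k : ℕ) (T : ℝ) : Summable (bbound ν k T) :=
  (Real.summable_pow_div_factorial _).mul_left _

lemma bc_abs {ν : ℝ} (hν : 1 ≤ ν) (m : ℕ) : |bc ν m| ≤ 1 / m.factorial := by
  have hG : 1 ≤ Real.Gamma (m + ν + 1) := by
    have h2 : (2:ℝ) ≤ m + ν + 1 := by have : (0:ℝ) ≤ m := m.cast_nonneg; linarith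
    have := Real.Gamma_strictMonoOn_Ici.monotoneOn (Set.mem_Ici.2 le_rfl) h2 h2
    rwa [Real.Gamma_two] at this
  have hf : (0:ℝ) < m.factorial := by positivity
  rw [bc, abs_div, abs_pow, abs_neg, abs_one, one_pow, abs_of_pos (by positivity)]
  apply one_div_le_one_div_of_le hf
  nlinarith

lemma bterm_bound {ν : ℝ} (hν : 1 ≤ ν) (k m : ℕ) {t T : ℝ} (h : t ≤ T) :
    ‖bterm ν k m t‖ ≤ bbound ν k T m := by
  have hm : (0:ℝ) ≤ m := m.cast_nonneg
  have hs : 0 ≤ 2 * (m:ℝ) + ν := by linarith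
  have h1 : (2 * (m:ℝ) + ν) ^ k ≤ k.factorial * exp (2 * m + ν) := by
    have := Real.pow_div_factorial_le_exp _ hs k
    rw [div_le_iff₀ (by positivity)] at this
    linarith
  have h2 : exp ((2 * m + ν) * (t - log 2)) ≤ exp ((2 * m + ν) * (T - log 2)) := by
    gcongr
  rw [bterm, Real.norm_eq_abs, abs_mul, abs_mul, abs_of_nonneg (pow_nonneg hs k), abs_of_pos (exp_pos _)]
  calc _ ≤ (1 / (m.factorial:ℝ)) * (k.factorial * exp (2 * m + ν)) * exp ((2 * m + ν) * (T - log 2)) := by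
        gcongr
        exact bc_abs hν m
    _ = bbound ν k T m := by
      rw [bbound, ← exp_nat_mul]
      have : exp (2 * m + ν) * exp ((2 * m + ν) * (T - log 2)) =
        exp (ν * (T - log 2 + 1)) * exp (m * (2 * (T - log 2 + 1))) := by
        rw [← exp_add, ← exp_add]; congr 1; ring
      calc _ = (1 / (m.factorial:ℝ)) * k.factorial * (exp (2 * m + ν) * exp ((2 * m + ν) * (T - log 2))) := by ring
        _ = _ := by rw [this]; ring

lemma bterm_summable {ν : ℝ} (hν : 1 ≤ ν) (k : ℕ) (t : ℝ) : Summable (fun m => bterm ν k m t) :=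
  Summable.of_norm_bounded (bbound_summable ν k t) (fun m => bterm_bound hν k m le_rfl)

lemma bfun_hasDerivAt {ν : ℝ} (hν : 1 ≤ ν) (k : ℕ) (t : ℝ) :
    HasDerivAt (bfun ν k) (bfun ν (k+1) t) t := by
  refine hasDerivAt_tsum_of_isPreconnected (u := bbound ν (k+1) (t+1)) (t := Set.Iio (t+1))
    (g := fun m => bterm ν k m) (g' := fun m => bterm ν (k+1) m)
    (bbound_summable _ _ _) isOpen_Iio isPreconnected_Iio ?_ ?_ (y₀ := t) (by simp)
    (bterm_summable hν k t) (by simp)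
  · intro m y _
    have h1 : HasDerivAt (fun y : ℝ => (2 * (m:ℝ) + ν) * (y - log 2)) (2 * m + ν) y := by
      simpa using ((hasDerivAt_id y).sub_const (log 2)).const_mul (2 * (m:ℝ) + ν)
    have h2 : HasDerivAt (bterm ν k m) _ y := (h1.exp).const_mul (bc ν m * (2 * m + ν) ^ k)
    refine h2.congr_deriv ?_
    simp only [bterm]; ring
  · intro m y hy
    exact bterm_bound hν _ m (le_of_lt hy)

lemma bc_succ {ν : ℝ} (hν : 1 ≤ ν) (m : ℕ) :
    bc ν (m+1) * ((m+1) * (m + 1 + ν)) = - bc ν m := by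
  have hm : (0:ℝ) ≤ m := m.cast_nonneg
  have h0 : (m + 1 + ν : ℝ) ≠ 0 := by linarith
  have hg : Real.Gamma (m + ν + 1) ≠ 0 := (Real.Gamma_pos_of_pos (by linarith)).ne'
  have hG : Real.Gamma (((m+1:ℕ):ℝ) + ν + 1) = (m + 1 + ν) * Real.Gamma (m + ν + 1) := by
    have := Real.Gamma_add_one (s := m + ν + 1) (by linarith)
    push_cast
    rw [show (m:ℝ) + 1 + ν + 1 = (m + ν + 1) + 1 by ring, this]; ring
  rw [bc, bc, hG, Nat.factorial_succ]
  push_cast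
  have hf : (m.factorial:ℝ) ≠ 0 := by positivity
  have h1 : (m:ℝ) + 1 ≠ 0 := by positivity
  field_simp
  ring

lemma bfun_ode {ν : ℝ} (hν : 1 ≤ ν) (t : ℝ) :
    bfun ν 2 t = (ν^2 - exp (2*t)) * bfun ν 0 t := by
  have h : bfun ν 2 t - ν^2 * bfun ν 0 t = - exp (2*t) * bfun ν 0 t := by
    have s2 := bterm_summable hν 2 t
    have s0 := bterm_summable hν 0 t
    simp only [bfun]
    rw [← tsum_mul_left, ← tsum_mul_left, ← s2.tsum_sub (s0.mul_left _),
      (s2.sub (s0.mul_left _)).tsum_eq_zero_add]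
    have z : bterm ν 2 0 t - ν^2 * bterm ν 0 0 t = 0 := by simp [bterm]; ring
    rw [z, zero_add]
    congr 1; ext m
    simp only [bterm]
    have e : exp ((2 * ((m+1:ℕ):ℝ) + ν) * (t - log 2)) =
        exp ((2 * m + ν) * (t - log 2)) * (exp (2*t) / 4) := by
      rw [show (4:ℝ) = exp (2 * log 2) by rw [two_mul, exp_add, exp_log two_pos]; norm_num,
        ← exp_sub, ← exp_add]
      congr 1; push_cast; ring
    rw [e]
    have := bc_succ hν m
    push_cast
    linear_combination exp ((2 * m + ν) * (t - log 2)) * exp (2*t) * this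
  linarith

lemma bfun_tendsto {ν : ℝ} (hν : 1 ≤ ν) (k : ℕ) :
    Tendsto (fun t => bfun ν k t * exp (-(ν * t))) atBot (𝓝 (bc ν 0 * ν ^ k * exp (-(ν * log 2)))) := by
  have key : Tendsto (fun t => ∑' m, bterm ν k m t * exp (-(ν * t))) atBot
      (𝓝 (∑' m : ℕ, if m = 0 then bc ν 0 * ν ^ k * exp (-(ν * log 2)) else 0)) := by
    have e : ∀ m t, bterm ν k m t * exp (-(ν * t)) =
        bc ν m * (2 * m + ν) ^ k * exp (-((2 * m + ν) * log 2)) * exp (2 * m * t) := by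
      intro m t
      rw [bterm, mul_assoc, mul_assoc _ _ (exp (2 * m * t)), ← exp_add, ← exp_add]
      congr 2; ring
    refine tendsto_tsum_of_dominated_convergence (bbound_summable ν k 0) ?_ ?_
    · intro m
      simp only [e]
      rcases Nat.eq_zero_or_pos m with rfl | hm
      · simp
      · rw [if_neg hm.ne']
        have : (0:ℝ) < 2 * m := by positivity
        have h1 : Tendsto (fun t : ℝ => exp (2 * m * t)) atBot (𝓝 0) :=
          tendsto_exp_atBot.comp (tendsto_id.const_mul_atBot this)
        simpa using h1.const_mul (bc ν m * (2 * m + ν) ^ k * exp (-((2 * m + ν) * log 2)))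
    · filter_upwards [eventually_le_atBot 0] with t ht m
      refine le_trans ?_ (bterm_bound hν k m (le_refl 0))
      rw [e]
      have e0 := e m 0
      simp only [mul_zero, neg_zero, exp_zero, mul_one] at e0
      rw [e0, norm_mul]
      apply mul_le_of_le_one_right (norm_nonneg _)
      rw [Real.norm_eq_abs, abs_of_pos (exp_pos _), exp_le_one_iff]
      have : (0:ℝ) ≤ m := m.cast_nonneg
      nlinarith
  rw [tsum_ite_eq] at key
  simpa only [bfun, tsum_mul_right] using key

lemma bfun_tendsto_zero {ν : ℝ} (hν : 1 ≤ ν) (k : ℕ) :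
    Tendsto (fun t => bfun ν k t) atBot (𝓝 0) := by
  have h1 : Tendsto (fun t : ℝ => exp (ν * t)) atBot (𝓝 0) :=
    tendsto_exp_atBot.comp (tendsto_id.const_mul_atBot (by linarith))
  have := (bfun_tendsto hν k).mul h1
  rw [mul_zero] at this
  refine this.congr fun t => ?_
  rw [mul_assoc, ← exp_add]; simp

lemma gamma_lower {ν : ℝ} (hν : 1 ≤ ν) :
    exp (-1) * (sqrt ν * exp (ν * log ν - ν)) ≤ Real.Gamma (ν + 1) := by
  have hν0 : 0 < ν := by linarith
  have hs : 0 < sqrt ν := sqrt_pos.2 hν0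
  have hss : sqrt ν * sqrt ν = ν := mul_self_sqrt hν0.le
  rw [Real.Gamma_eq_integral (by linarith)]
  have hint := Real.GammaIntegral_convergent (s := ν + 1) (by linarith)
  have hsub : Set.Ioc ν (ν + sqrt ν) ⊆ Set.Ioi 0 := fun x hx => lt_trans hν0 hx.1
  have hle : ∫ x in Set.Ioc ν (ν + sqrt ν), exp (-x) * x ^ (ν + 1 - 1) ≤
      ∫ x in Set.Ioi 0, exp (-x) * x ^ (ν + 1 - 1) := by
    apply MeasureTheory.setIntegral_mono_set hint
    · filter_upwards [MeasureTheory.ae_restrict_mem measurableSet_Ioi] with x hx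
      have : (0:ℝ) < x := hx
      simp only [Pi.zero_apply]
      positivity
    · exact hsub.eventuallyLE
  refine le_trans ?_ hle
  have hc : ∫ x in Set.Ioc ν (ν + sqrt ν), exp (-1) * exp (ν * log ν - ν) =
      exp (-1) * (sqrt ν * exp (ν * log ν - ν)) := by
    rw [MeasureTheory.setIntegral_const]
    simp [hs.le]
    ring
  rw [← hc]
  apply MeasureTheory.setIntegral_mono_on
  · exact MeasureTheory.integrableOn_const (by simp)
  · exact hint.mono_set hsub
  · exact measurableSet_Ioc
  · intro x hx
    have hx0 : 0 < x := hsub hx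
    rw [rpow_def_of_pos hx0, ← exp_add, ← exp_add]
    apply exp_le_exp.2
    have hl := Real.le_log_one_add_of_nonneg (x := (x - ν) / ν) (div_nonneg (by linarith [hx.1]) hν0.le)
    rw [show 1 + (x - ν) / ν = x / ν by field_simp; ring, log_div hx0.ne' hν0.ne'] at hl
    have h3 : 2 * ((x - ν) / ν) / ((x - ν) / ν + 2) = 2 * (x - ν) / (x + ν) := by
      rw [div_eq_div_iff] <;> [(field_simp; ring); (have := hx.1; have : 0 ≤ (x - ν)/ν := div_nonneg (by linarith) hν0.le; linarith); linarith]
    rw [h3] at hl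
    have h4 : x - ν - 1 ≤ ν * (2 * (x - ν) / (x + ν)) := by
      rw [← mul_div_assoc, le_div_iff₀ (by linarith)]
      nlinarith [hx.1, hx.2, mul_nonneg (sub_nonneg.2 hx.1.le) (sub_nonneg.2 hx.1.le), mul_nonneg (sub_nonneg.2 hx.2) (sub_nonneg.2 hx.1.le), mul_nonneg (sub_nonneg.2 hx.2) hs.le]
    have h5 := mul_le_mul_of_nonneg_left hl hν0.le
    nlinarith

lemma bessel_eq {ν : ℝ} {x : ℝ} (hx : 0 < x) : besselJ ν x = bfun ν 0 (log x) := by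
  rw [besselJ, bfun]
  congr 1; ext m
  rw [bterm, rpow_def_of_pos (by positivity), log_div hx.ne' two_ne_zero, bc]
  rw [pow_zero, mul_one, mul_comm (log x - log 2)]
lemma anti_of_hasDerivAt {f f' : ℝ → ℝ} {D : Set ℝ} (hD : Convex ℝ D)
    (h : ∀ x ∈ D, HasDerivAt f (f' x) x) (h' : ∀ x ∈ D, f' x ≤ 0) : AntitoneOn f D := by
  apply antitoneOn_of_deriv_nonpos hD
  · exact fun x hx => (h x hx).continuousAt.continuousWithinAt
  · exact fun x hx => (h x (interior_subset hx)).differentiableAt.differentiableWithinAt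
  · intro x hx
    rw [(h x (interior_subset hx)).deriv]
    exact h' x (interior_subset hx)

lemma le_lim_of_anti {f : ℝ → ℝ} {b L : ℝ} (h : AntitoneOn f (Set.Iio b))
    (hl : Tendsto f atBot (𝓝 L)) {t : ℝ} (ht : t < b) : f t ≤ L := by
  apply ge_of_tendsto hl
  filter_upwards [eventually_le_atBot t] with s hs
  exact h (lt_of_le_of_lt hs ht) ht hs

lemma exp_two_mul_sq (t : ℝ) : exp (2 * t) = exp t ^ 2 := by
  rw [two_mul, exp_add, sq]

lemma exp_lt_of_lt_log {ν t : ℝ} (hν : 1 ≤ ν) (ht : t < log ν) : exp (2 * t) < ν ^ 2 := by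
  rw [exp_two_mul_sq]
  have := (lt_log_iff_exp_lt (by linarith : 0 < ν)).1 ht
  have := exp_pos t
  nlinarith

lemma hasDerivAt_exp_two (t : ℝ) : HasDerivAt (fun t : ℝ => exp (2 * t)) (2 * exp (2 * t)) t := by
  have := ((hasDerivAt_id t).const_mul 2).exp
  simpa [mul_comm] using this

/-- positivity and monotonicity below the turning point -/
lemma bfun_mono {ν : ℝ} (hν : 1 ≤ ν) {t : ℝ} (ht : t < log ν) :
    0 ≤ bfun ν 0 t * bfun ν 1 t := by
  have h1 : AntitoneOn (fun t => -(bfun ν 0 t * bfun ν 1 t)) (Set.Iio (log ν)) := by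
    refine anti_of_hasDerivAt (convex_Iio _)
      (fun s _ => ((bfun_hasDerivAt hν 0 s).mul (bfun_hasDerivAt hν 1 s)).neg) ?_
    intro s hs
    simp only [zero_add, Nat.reduceAdd]
    rw [bfun_ode hν s]
    have := exp_lt_of_lt_log hν hs
    nlinarith [sq_nonneg (bfun ν 1 s), mul_nonneg (sub_nonneg.2 this.le) (sq_nonneg (bfun ν 0 s))]
  have h2 : Tendsto (fun t => -(bfun ν 0 t * bfun ν 1 t)) atBot (𝓝 0) := by
    simpa using ((bfun_tendsto_zero hν 0).mul (bfun_tendsto_zero hν 1)).neg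
  have := le_lim_of_anti h1 h2 ht
  linarith

lemma bfun_pos {ν : ℝ} (hν : 1 ≤ ν) {t : ℝ} (ht : t < log ν) : 0 < bfun ν 0 t := by
  have hc : 0 < bc ν 0 * ν ^ 0 * exp (-(ν * log 2)) := by
    have : 0 < Real.Gamma (ν + 1) := Real.Gamma_pos_of_pos (by linarith)
    simp only [bc]
    simp
    positivity
  have hev := (bfun_tendsto hν 0).eventually (lt_mem_nhds hc)
  have hev' : ∀ᶠ s in atBot, 0 < bfun ν 0 s := by
    filter_upwards [hev] with s hs
    exact pos_of_mul_pos_left hs (exp_pos _).le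
  obtain ⟨s, hs, hst⟩ := (hev'.and (eventually_le_atBot t)).exists
  have hmono : AntitoneOn (fun t => -(bfun ν 0 t * bfun ν 0 t)) (Set.Iio (log ν)) := by
    refine anti_of_hasDerivAt (convex_Iio _)
      (fun s _ => ((bfun_hasDerivAt hν 0 s).mul (bfun_hasDerivAt hν 0 s)).neg) ?_
    intro r hr
    have := bfun_mono hν hr
    simp only [zero_add]
    linarith
  by_contra hneg
  push Not at hneg
  have hcont : ContinuousOn (bfun ν 0) (Set.Icc s t) :=
    fun x _ => (bfun_hasDerivAt hν 0 x).continuousAt.continuousWithinAt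
  obtain ⟨z, hz, hz0⟩ := intermediate_value_Icc' hst hcont ⟨hneg, hs.le⟩
  have := hmono (lt_of_le_of_lt hst ht) (lt_of_le_of_lt hz.2 ht) hz.1
  simp only [hz0] at this
  nlinarith

noncomputable def wS (ν t : ℝ) : ℝ := sqrt (ν^2 - exp (2*t)) + ν * t - ν * log (ν + sqrt (ν^2 - exp (2*t)))
noncomputable def wv (ν t : ℝ) : ℝ := sqrt (ν^2 - exp (2*t)) + exp (2*t) / (2 * (ν^2 - exp (2*t)))
noncomputable def ww (ν t : ℝ) : ℝ := exp (wS ν t - log (ν^2 - exp (2*t)) / 4)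

lemma hasDerivAt_p (ν t : ℝ) :
    HasDerivAt (fun t => ν^2 - exp (2*t)) (-(2 * exp (2*t))) t := by
  simpa using (hasDerivAt_exp_two t).const_sub (ν^2)

lemma hasDerivAt_r {ν t : ℝ} (hν : 1 ≤ ν) (ht : t < log ν) :
    HasDerivAt (fun t => sqrt (ν^2 - exp (2*t))) (-(exp (2*t) / sqrt (ν^2 - exp (2*t)))) t := by
  have hp := sub_pos.2 (exp_lt_of_lt_log hν ht)
  refine ((hasDerivAt_p ν t).sqrt hp.ne').congr_deriv ?_
  have := sqrt_pos.2 hp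
  field_simp

lemma wS_deriv {ν t : ℝ} (hν : 1 ≤ ν) (ht : t < log ν) :
    HasDerivAt (wS ν) (sqrt (ν^2 - exp (2*t))) t := by
  have hp := sub_pos.2 (exp_lt_of_lt_log hν ht)
  have hr := sqrt_pos.2 hp
  have hr2 := sq_sqrt hp.le
  have hd := hasDerivAt_r hν ht
  have h := (hd.add ((hasDerivAt_id t).const_mul ν)).sub
    (((hd.const_add ν).log (by positivity)).const_mul ν)
  refine h.congr_deriv ?_
  set r := sqrt (ν^2 - exp (2*t))
  have : exp (2*t) = ν^2 - r^2 := by linarith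
  rw [this]
  field_simp
  ring

lemma ww_deriv {ν t : ℝ} (hν : 1 ≤ ν) (ht : t < log ν) :
    HasDerivAt (ww ν) (wv ν t * ww ν t) t := by
  have hp := sub_pos.2 (exp_lt_of_lt_log hν ht)
  have h := ((wS_deriv hν ht).sub (((hasDerivAt_p ν t).log hp.ne').div_const 4)).exp
  refine h.congr_deriv ?_
  simp only [ww, wv, Pi.sub_apply]
  rw [mul_comm]
  congr 1
  field_simp
  ring

lemma wv_deriv {ν t : ℝ} (hν : 1 ≤ ν) (ht : t < log ν) :
    ∃ d, HasDerivAt (wv ν) d t ∧ ν^2 - exp (2*t) ≤ d + wv ν t ^ 2 := by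
  have hp := sub_pos.2 (exp_lt_of_lt_log hν ht)
  have hr := sqrt_pos.2 hp
  have hr2 := sq_sqrt hp.le
  refine ⟨_, (hasDerivAt_r hν ht).add ((hasDerivAt_exp_two t).div ((hasDerivAt_p ν t).const_mul 2)
    (by positivity)), ?_⟩
  simp only [wv]
  set r := sqrt (ν^2 - exp (2*t))
  set X := exp (2*t) with hX
  have hXp : 0 < X := exp_pos _
  rw [← sub_nonneg]
  have : -(X / r) + (2 * X * (2 * (ν^2 - X)) - X * (2 * -(2 * X))) / (2 * (ν^2 - X))^2
      + (r + X / (2 * (ν^2 - X)))^2 - (ν^2 - X)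
      = 5 * X^2 / (4 * (ν^2-X)^2) + X / (ν^2 - X) := by
    rw [← hr2]
    field_simp
    ring
  rw [this]
  positivity

lemma wv_tendsto {ν : ℝ} (hν : 1 ≤ ν) : Tendsto (wv ν) atBot (𝓝 ν) := by
  have h1 : Tendsto (fun t : ℝ => exp (2 * t)) atBot (𝓝 0) :=
    tendsto_exp_atBot.comp (tendsto_id.const_mul_atBot (by norm_num))
  have h2 : Tendsto (fun t : ℝ => ν^2 - exp (2 * t)) atBot (𝓝 (ν^2)) := by
    simpa using h1.const_sub (ν^2)
  have h3 := h2.sqrt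
  rw [sqrt_sq (by linarith)] at h3
  have h4 := h1.div (h2.const_mul 2) (by positivity)
  have h5 := h3.add h4
  rw [zero_div, add_zero] at h5
  exact h5

lemma ww_tendsto {ν : ℝ} (hν : 1 ≤ ν) : Tendsto (fun t => ww ν t * exp (-(ν * t))) atBot
    (𝓝 (exp (ν - ν * log (2 * ν) - log ν / 2))) := by
  have h1 : Tendsto (fun t : ℝ => exp (2 * t)) atBot (𝓝 0) :=
    tendsto_exp_atBot.comp (tendsto_id.const_mul_atBot (by norm_num))
  have h2 : Tendsto (fun t : ℝ => ν^2 - exp (2 * t)) atBot (𝓝 (ν^2)) := by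
    simpa using h1.const_sub (ν^2)
  have h3 := h2.sqrt
  rw [sqrt_sq (by linarith)] at h3
  have h5 := ((h3.sub (((h3.const_add ν).log (by linarith)).const_mul ν)).sub
    ((h2.log (by positivity)).div_const 4)).rexp
  have e : ν - ν * log (ν + ν) - log (ν^2) / 4 = ν - ν * log (2 * ν) - log ν / 2 := by
    rw [log_pow, two_mul ν]; push_cast; ring
  rw [e] at h5
  refine h5.congr fun t => ?_
  rw [ww, ← exp_add, wS]
  congr 1; ring

lemma wD_nonpos {ν t : ℝ} (hν : 1 ≤ ν) (ht : t < log ν) :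
    bfun ν 1 t ≤ wv ν t * bfun ν 0 t := by
  have hex : ∀ s, ∃ d, s < log ν → HasDerivAt (wv ν) d s ∧ ν^2 - exp (2*s) ≤ d + wv ν s ^ 2 := by
    intro s
    by_cases hs : s < log ν
    · obtain ⟨d, hd⟩ := wv_deriv hν hs
      exact ⟨d, fun _ => hd⟩
    · exact ⟨0, fun h => absurd h hs⟩
  choose d hd using hex
  have h1 : AntitoneOn (fun t => (bfun ν 1 t - wv ν t * bfun ν 0 t) * ww ν t) (Set.Iio (log ν)) := by
    refine anti_of_hasDerivAt (convex_Iio _)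
      (fun s hs => ((bfun_hasDerivAt hν 1 s).sub ((hd s hs).1.mul (bfun_hasDerivAt hν 0 s))).mul
        (ww_deriv hν hs)) ?_
    intro s hs
    simp only [zero_add, Nat.reduceAdd, Pi.sub_apply, Pi.mul_apply]
    rw [bfun_ode hν s]
    have hy := bfun_pos hν hs
    have hw : 0 < ww ν s := exp_pos _
    have := mul_nonneg (sub_nonneg.2 (hd s hs).2) (mul_pos hy hw).le
    nlinarith
  have hw0 : Tendsto (ww ν) atBot (𝓝 0) := by
    have h1 : Tendsto (fun t : ℝ => exp (ν * t)) atBot (𝓝 0) :=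
      tendsto_exp_atBot.comp (tendsto_id.const_mul_atBot (by linarith))
    have := (ww_tendsto hν).mul h1
    rw [mul_zero] at this
    refine this.congr fun t => ?_
    rw [mul_assoc, ← exp_add]; simp
  have h2 : Tendsto (fun t => (bfun ν 1 t - wv ν t * bfun ν 0 t) * ww ν t) atBot (𝓝 0) := by
    simpa using ((bfun_tendsto_zero hν 1).sub ((wv_tendsto hν).mul (bfun_tendsto_zero hν 0))).mul hw0
  have h3 := le_lim_of_anti h1 h2 ht
  have hw : 0 < ww ν t := exp_pos _
  by_contra hcon
  push Not at hcon
  have := mul_pos (sub_pos.2 hcon) hw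
  linarith

lemma bfun_le_ww {ν t : ℝ} (hν : 1 ≤ ν) (ht : t < log ν) :
    bfun ν 0 t ≤ exp 1 * ww ν t := by
  have hwp : ∀ s, 0 < ww ν s := fun s => exp_pos _
  have h1 : AntitoneOn (fun t => bfun ν 0 t / ww ν t) (Set.Iio (log ν)) := by
    refine anti_of_hasDerivAt (convex_Iio _)
      (fun s hs => (bfun_hasDerivAt hν 0 s).div (ww_deriv hν hs) (hwp s).ne') ?_
    intro s hs
    apply div_nonpos_of_nonpos_of_nonneg _ (sq_nonneg _)
    have := mul_nonneg (sub_nonneg.2 (wD_nonpos hν hs)) (hwp s).le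
    simp only [zero_add]
    nlinarith
  have h2 := (bfun_tendsto hν 0).div (ww_tendsto hν) (exp_pos _).ne'
  have h3 : Tendsto (fun t => bfun ν 0 t / ww ν t) atBot _ := h2.congr fun t => by
    have := exp_pos (-(ν*t))
    have := hwp t
    simp only [Pi.div_apply]
    field_simp
  have h4 := le_lim_of_anti h1 h3 ht
  have h5 : bc ν 0 * ν ^ 0 * exp (-(ν * log 2)) / exp (ν - ν * log (2 * ν) - log ν / 2) ≤ exp 1 := by
    have hν0 : 0 < ν := by linarith
    have hG : 0 < Real.Gamma (ν + 1) := Real.Gamma_pos_of_pos (by linarith)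
    have hg := gamma_lower hν
    have hs : sqrt ν = exp (log ν / 2) := by
      rw [sqrt_eq_rpow, rpow_def_of_pos hν0]; congr 1; ring
    rw [hs, ← exp_add, ← exp_add] at hg
    simp only [bc]
    simp only [pow_zero, Nat.factorial_zero, Nat.cast_one, Nat.cast_zero, zero_add, one_mul, mul_one]
    rw [div_le_iff₀ (exp_pos _), ← exp_add, div_mul_eq_mul_div, one_mul, div_le_iff₀ hG]
    refine le_trans (le_of_eq ?_) (mul_le_mul_of_nonneg_left hg (exp_pos _).le)
    rw [← exp_add, log_mul two_ne_zero hν0.ne']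
    congr 1; ring
  have h6 := h4.trans h5
  rwa [div_le_iff₀ (hwp t)] at h6

lemma wS_nonpos {ν t : ℝ} (hν : 1 ≤ ν) (ht : t < log ν) : wS ν t ≤ 0 := by
  have h : MonotoneOn (wS ν) (Set.Iic (log ν)) := by
    apply monotoneOn_of_deriv_nonneg (convex_Iic _)
    · have h1 : Continuous (fun t => sqrt (ν^2 - exp (2*t))) := by fun_prop
      refine Continuous.continuousOn ?_
      unfold wS
      refine (h1.add (by fun_prop)).sub (continuous_const.mul ((continuous_const.add h1).log ?_))
      intro x
      have := sqrt_nonneg (ν^2 - exp (2*x))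
      simp only [Pi.add_apply]
      linarith
    · intro x hx
      rw [interior_Iic] at hx
      exact (wS_deriv hν hx).differentiableAt.differentiableWithinAt
    · intro x hx
      rw [interior_Iic] at hx
      rw [(wS_deriv hν hx).deriv]
      exact sqrt_nonneg _
  have := h (Set.mem_Iic.2 ht.le) (Set.mem_Iic.2 le_rfl) ht.le
  refine this.trans (le_of_eq ?_)
  rw [wS, exp_two_mul_sq, exp_log (by linarith)]
  simp

/-- data at the left end of the transition zone -/
lemma zone_start {a : ℝ} (ha : 1 ≤ a) :
    bfun (a^3) 1 (log (a^3 - a/2)) ^ 2 + a^4 * bfun (a^3) 0 (log (a^3 - a/2)) ^ 2 ≤ 180 * a^2 := by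
  have hν : 1 ≤ a^3 := one_le_pow₀ ha
  have ha3 : a ≤ a^3 := by nlinarith [mul_nonneg (by linarith : 0 ≤ a) (by nlinarith : 0 ≤ a^2 - 1)]
  have hx : 0 < a^3 - a/2 := by linarith
  set t := log (a^3 - a/2) with htdef
  have ht : t < log (a^3) := log_lt_log hx (by linarith)
  have hX : exp (2*t) = (a^3 - a/2)^2 := by rw [exp_two_mul_sq, htdef, exp_log hx]
  have hp : (a^3)^2 - exp (2*t) = a^4 - a^2/4 := by rw [hX]; ring
  have ha2 : 1 ≤ a^2 := one_le_pow₀ ha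
  have ha4 : a^2 ≤ a^4 := by nlinarith
  have hp1 : (a/2)^4 ≤ a^4 - a^2/4 := by nlinarith
  have hw : ww (a^3) t ≤ 2 / a := by
    have h1 : log (a/2) ≤ log (a^4 - a^2/4) / 4 := by
      have := log_le_log (by positivity) hp1
      rw [log_pow] at this
      push_cast at this
      linarith
    have h2 := wS_nonpos hν ht
    rw [ww, hp]
    calc _ ≤ exp (-log (a/2)) := exp_le_exp.2 (by linarith)
      _ = 2 / a := by rw [exp_neg, exp_log (by positivity)]; simp
  have hy0 := bfun_pos hν ht
  have hy : bfun (a^3) 0 t ≤ 6 / a := by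
    refine (bfun_le_ww hν ht).trans ?_
    have h3 : exp 1 ≤ 3 := by linarith [exp_one_lt_d9]
    calc exp 1 * ww (a^3) t ≤ 3 * (2 / a) := mul_le_mul h3 hw (exp_pos _).le (by norm_num)
      _ = 6 / a := by ring
  have hv : wv (a^3) t ≤ 2 * a^2 := by
    rw [wv, hp, hX]
    have h1 : sqrt (a^4 - a^2/4) ≤ a^2 := by
      rw [sqrt_le_left (by positivity)]; nlinarith
    have h2 : (a^3 - a/2)^2 / (2 * (a^4 - a^2/4)) ≤ a^2 := by
      rw [div_le_iff₀ (by nlinarith)]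
      nlinarith [mul_nonneg (sub_nonneg.2 ha4) (by linarith : 0 ≤ a^2)]
    linarith
  have hy1 : 0 ≤ bfun (a^3) 1 t := by
    have := bfun_mono hν ht
    exact nonneg_of_mul_nonneg_right this hy0
  have hya : a * bfun (a^3) 0 t ≤ 6 := by
    rw [le_div_iff₀ (by linarith)] at hy; linarith
  have hy1' : bfun (a^3) 1 t ≤ 12 * a := by
    calc _ ≤ wv (a^3) t * bfun (a^3) 0 t := wD_nonpos hν ht
      _ ≤ 2 * a^2 * bfun (a^3) 0 t := by gcongr
      _ = 2 * a * (a * bfun (a^3) 0 t) := by ring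
      _ ≤ 2 * a * 6 := by gcongr
      _ = _ := by ring
  have e1 : bfun (a^3) 1 t ^ 2 ≤ (12 * a)^2 := pow_le_pow_left₀ hy1 hy1' 2
  have e2 : (a * bfun (a^3) 0 t)^2 ≤ 6^2 := pow_le_pow_left₀ (by positivity) hya 2
  have e3 := mul_le_mul_of_nonneg_left e2 (sq_nonneg a)
  calc _ = bfun (a^3) 1 t ^ 2 + a^2 * (a * bfun (a^3) 0 t)^2 := by ring
    _ ≤ _ := by linarith

/-- transition zone -/
lemma zone_mid {a t : ℝ} (ha : 1 ≤ a) (h0 : log (a^3 - a/2) ≤ t) (h1 : t ≤ log (a^3 + a)) :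
    bfun (a^3) 1 t ^ 2 + a^4 * bfun (a^3) 0 t ^ 2 ≤ 180 * exp 6 * a^2 := by
  have hν : 1 ≤ a^3 := one_le_pow₀ ha
  have ha3 : a ≤ a^3 := by nlinarith [mul_nonneg (by linarith : 0 ≤ a) (by nlinarith : 0 ≤ a^2 - 1)]
  have hx : 0 < a^3 - a/2 := by linarith
  have ha2 : 1 ≤ a^2 := one_le_pow₀ ha
  have ha4 : a^2 ≤ a^4 := by nlinarith
  have hanti : AntitoneOn (fun t => (bfun (a^3) 1 t ^ 2 + a^4 * bfun (a^3) 0 t ^ 2) *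
      exp (-(2 * a^2 * t))) (Set.Icc (log (a^3 - a/2)) (log (a^3 + a))) := by
    have he : ∀ s : ℝ, HasDerivAt (fun t : ℝ => exp (-(2 * a^2 * t))) (exp (-(2 * a^2 * s)) * (-(2 * a^2))) s := by
      intro s
      have := (((hasDerivAt_id s).const_mul (2 * a^2)).neg).exp
      simpa using this
    refine anti_of_hasDerivAt (convex_Icc _ _)
      (fun s _ => (((bfun_hasDerivAt hν 1 s).pow 2).add
        (((bfun_hasDerivAt hν 0 s).pow 2).const_mul (a^4))).mul (he s)) ?_
    intro s hs
    simp only [zero_add, Nat.reduceAdd, Pi.add_apply, Pi.pow_apply]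
    rw [bfun_ode hν s]
    have hl : a^3 - a/2 ≤ exp s := (log_le_iff_le_exp hx).1 hs.1
    have hr : exp s ≤ a^3 + a := (le_log_iff_exp_le (by linarith)).1 hs.2
    have hX1 : (a^3 - a/2)^2 ≤ exp (2*s) := by
      rw [exp_two_mul_sq]; exact pow_le_pow_left₀ hx.le hl 2
    have hX2 : exp (2*s) ≤ (a^3 + a)^2 := by
      rw [exp_two_mul_sq]; exact pow_le_pow_left₀ (exp_pos _).le hr 2
    set p := (a^3)^2 - exp (2*s) with hpdef
    have hp1 : p + a^4 ≤ 2 * a^4 := by nlinarith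
    have hp2 : -(2 * a^4) ≤ p + a^4 := by nlinarith
    set y := bfun (a^3) 0 s
    set z := bfun (a^3) 1 s
    set E := exp (-(2 * a^2 * s))
    have hE : 0 < E := exp_pos _
    have key : 2 * (y * z) * (p + a^4) ≤ 2 * a^2 * (z^2 + a^4 * y^2) := by
      have hab : |2 * (y * z) * (p + a^4)| ≤ 2 * |y * z| * (2 * a^4) := by
        rw [abs_mul, abs_mul, abs_two]
        gcongr
        exact abs_le.2 ⟨hp2, hp1⟩
      have hyz : 2 * a^2 * |y * z| ≤ z^2 + a^4 * y^2 := by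
        have := sq_nonneg (|z| - a^2 * |y|)
        rw [abs_mul]
        nlinarith [sq_abs z, sq_abs y]
      have := mul_le_mul_of_nonneg_left hyz (by positivity : 0 ≤ 2 * a^2)
      calc _ ≤ _ := le_abs_self _
        _ ≤ _ := hab
        _ = 2 * a^2 * (2 * a^2 * |y * z|) := by ring
        _ ≤ _ := this
    have := mul_nonneg (sub_nonneg.2 key) hE.le
    push_cast
    nlinarith
  have hlt : log (a^3 - a/2) ≤ log (a^3 + a) := h0.trans h1
  have hh := hanti (Set.left_mem_Icc.2 hlt) ⟨h0, h1⟩ h0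
  simp only at hh
  have hs := zone_start ha
  set t0 := log (a^3 - a/2) with ht0
  have hdt : 2 * a^2 * t - 2 * a^2 * t0 ≤ 6 := by
    have h2 : log (a^3 + a) - t0 ≤ 3 / a^2 := by
      rw [ht0, ← log_div (by positivity) hx.ne']
      refine (log_le_sub_one_of_pos (by positivity)).trans ?_
      rw [div_sub_one hx.ne', div_le_div_iff₀ hx (by positivity)]
      nlinarith
    have h3 : a^2 * (t - t0) ≤ 3 := by
      have : t - t0 ≤ 3 / a^2 := by linarith
      rw [le_div_iff₀ (by positivity)] at this
      linarith
    linarith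
  calc _ = ((bfun (a^3) 1 t ^ 2 + a^4 * bfun (a^3) 0 t ^ 2) * exp (-(2 * a^2 * t))) * exp (2 * a^2 * t) := by
        rw [mul_assoc, ← exp_add]; simp
    _ ≤ ((bfun (a^3) 1 t0 ^ 2 + a^4 * bfun (a^3) 0 t0 ^ 2) * exp (-(2 * a^2 * t0))) * exp (2 * a^2 * t) := by
        gcongr
    _ = (bfun (a^3) 1 t0 ^ 2 + a^4 * bfun (a^3) 0 t0 ^ 2) * exp (2 * a^2 * t - 2 * a^2 * t0) := by
        rw [mul_assoc, ← exp_add]; congr 2; ring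
    _ ≤ 180 * a^2 * exp 6 := by gcongr
    _ = _ := by ring

set_option maxHeartbeats 1600000 in
/-- the oscillatory zone -/
lemma zone_osc {a t : ℝ} (ha : 1 ≤ a) (h0 : log (a^3 + a) ≤ t) (h1 : exp t ≤ 5/2 * a^3) :
    sqrt (exp (2*t) - a^6) * bfun (a^3) 0 t ^ 2 ≤ 720 * exp 6 * exp 3 := by
  have hν : 1 ≤ a^3 := one_le_pow₀ ha
  have ha3 : a ≤ a^3 := by nlinarith [mul_nonneg (by linarith : 0 ≤ a) (by nlinarith : 0 ≤ a^2 - 1)]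
  have ha2 : 1 ≤ a^2 := one_le_pow₀ ha
  have ha4 : a^2 ≤ a^4 := by nlinarith
  have hx : 0 < a^3 + a := by linarith
  set b : ℝ → ℝ := fun t => sqrt (exp (2*t) - a^6) with hb
  set κ : ℝ → ℝ := fun t => exp (2*t) / (2 * (exp (2*t) - a^6)) with hκ
  set G : ℝ → ℝ := fun t => b t * bfun (a^3) 0 t ^ 2 + (bfun (a^3) 1 t + κ t * bfun (a^3) 0 t)^2 / b t with hG
  set H : ℝ → ℝ := fun t => exp (3 * a^6 / ((exp (2*t) - a^6) * b t)) with hH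
  have hq : ∀ s, log (a^3 + a) ≤ s → 2 * a^4 ≤ exp (2*s) - a^6 := by
    intro s hs
    have hl : a^3 + a ≤ exp s := (log_le_iff_le_exp hx).1 hs
    have := pow_le_pow_left₀ hx.le hl 2
    rw [← exp_two_mul_sq] at this
    nlinarith
  have hanti : AntitoneOn (fun t => G t * H t) (Set.Icc (log (a^3 + a)) t) := by
    have hbd : ∀ s ∈ Set.Icc (log (a^3 + a)) t, HasDerivAt b (exp (2*s) / b s) s := by
      intro s hs
      have hqs := hq s hs.1
      have hqp : 0 < exp (2*s) - a^6 := by nlinarith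
      refine (((hasDerivAt_exp_two s).sub_const (a^6)).sqrt hqp.ne').congr_deriv ?_
      have := sqrt_pos.2 hqp
      simp only [hb]
      field_simp
    have hκd : ∀ s ∈ Set.Icc (log (a^3 + a)) t, HasDerivAt κ
        (exp (2*s) / (exp (2*s) - a^6) - exp (2*s)^2 / (exp (2*s) - a^6)^2) s := by
      intro s hs
      have hqs := hq s hs.1
      have hqp : 0 < exp (2*s) - a^6 := by nlinarith
      refine ((hasDerivAt_exp_two s).div (((hasDerivAt_exp_two s).sub_const (a^6)).const_mul 2)
        (by positivity)).congr_deriv ?_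
      field_simp
    have hbp : ∀ s ∈ Set.Icc (log (a^3 + a)) t, 0 < b s := by
      intro s hs
      have hqs := hq s hs.1
      exact sqrt_pos.2 (by nlinarith)
    have hHd : ∀ s ∈ Set.Icc (log (a^3 + a)) t, HasDerivAt H
        (-(9 * a^6 * exp (2*s) / ((exp (2*s) - a^6)^2 * b s)) * H s) s := by
      intro s hs
      have hqs := hq s hs.1
      have hqp : 0 < exp (2*s) - a^6 := by nlinarith
      have hb0 := hbp s hs
      have hb2 : b s ^ 2 = exp (2*s) - a^6 := sq_sqrt hqp.le
      have h := ((hasDerivAt_const s (3 * a^6)).div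
        (((hasDerivAt_exp_two s).sub_const (a^6)).mul (hbd s hs)) (mul_pos hqp hb0).ne').exp
      refine h.congr_deriv ?_
      rw [mul_comm]
      simp only [hH, Pi.div_apply, Pi.mul_apply]
      congr 1
      set X := exp (2*s)
      set B := b s
      rw [← hb2]
      field_simp
      ring
    have hGd : ∀ s ∈ Set.Icc (log (a^3 + a)) t, HasDerivAt G
        (2 / b s * (exp (2*s) / (exp (2*s) - a^6) - 5/4 * (exp (2*s)^2 / (exp (2*s) - a^6)^2)) *
          (bfun (a^3) 1 s + κ s * bfun (a^3) 0 s) * bfun (a^3) 0 s) s := by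
      intro s hs
      have hqs := hq s hs.1
      have hqp : 0 < exp (2*s) - a^6 := by nlinarith
      have hb0 := hbp s hs
      have hb2 : b s ^ 2 = exp (2*s) - a^6 := sq_sqrt hqp.le
      have hy := bfun_hasDerivAt hν 0 s
      have hz := bfun_hasDerivAt hν 1 s
      have h := ((hbd s hs).mul (hy.pow 2)).add
        (((hz.add ((hκd s hs).mul hy)).pow 2).div (hbd s hs) hb0.ne')
      refine h.congr_deriv ?_
      simp only [zero_add, Nat.reduceAdd, Pi.add_apply, Pi.pow_apply, Pi.mul_apply]
      rw [bfun_ode hν s]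
      have hκs : κ s = exp (2*s) / (2 * (exp (2*s) - a^6)) := rfl
      rw [hκs]
      set X := exp (2*s)
      set B := b s
      rw [show (a^3)^2 - X = -(X - a^6) by ring, ← hb2]
      push_cast
      field_simp
      ring
    refine anti_of_hasDerivAt (convex_Icc _ _) (fun s hs => (hGd s hs).mul (hHd s hs)) ?_
    intro s hs
    have hqs := hq s hs.1
    have hqp : 0 < exp (2*s) - a^6 := by nlinarith
    have hb0 := hbp s hs
    have hX : exp (2*s) ≤ 25/4 * a^6 := by
      have h2 : exp s ≤ 5/2 * a^3 := (exp_le_exp.2 hs.2).trans h1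
      have := pow_le_pow_left₀ (exp_pos s).le h2 2
      rw [← exp_two_mul_sq] at this
      nlinarith
    have hXp := exp_pos (2*s)
    have hHp : 0 < H s := exp_pos _
    set A := bfun (a^3) 1 s + κ s * bfun (a^3) 0 s with hA
    set y := bfun (a^3) 0 s
    have hGs : G s = b s * y^2 + A^2 / b s := rfl
    have hAy : 2 * |A * y| ≤ G s := by
      rw [hGs, abs_mul]
      have e : b s * y^2 + A^2 / b s - 2 * (|A| * |y|) = (b s * |y| - |A|)^2 / b s := by
        rw [← sq_abs y, ← sq_abs A]; field_simp; ring
      have : 0 ≤ (b s * |y| - |A|)^2 / b s := by positivity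
      linarith
    have hG0 : 0 ≤ G s := by rw [hGs]; positivity
    set X := exp (2*s)
    have a6 : 0 ≤ a^6 := by positivity
    have hψ : |X / (X - a^6) - 5/4 * (X^2 / (X - a^6)^2)| ≤ 9 * a^6 * X / (X - a^6)^2 := by
      have e1 : X / (X - a^6) - 5/4 * (X^2 / (X - a^6)^2) = (X * (X - a^6) - 5/4 * X^2) / (X - a^6)^2 := by
        field_simp
      rw [e1, abs_div, abs_of_pos (by positivity : 0 < (X - a^6)^2)]
      gcongr
      rw [abs_le]
      constructor <;> nlinarith
    have hmain : 2 / b s * (X / (X - a^6) - 5/4 * (X^2 / (X - a^6)^2)) * A * y ≤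
        9 * a^6 * X / ((X - a^6)^2 * b s) * G s := by
      calc _ = (X / (X - a^6) - 5/4 * (X^2 / (X - a^6)^2)) * (2 * (A * y)) / b s := by ring
        _ ≤ (9 * a^6 * X / (X - a^6)^2) * G s / b s := by
          refine div_le_div_of_nonneg_right ?_ hb0.le
          refine (le_abs_self _).trans ?_
          rw [abs_mul, abs_mul 2, abs_two]
          gcongr
        _ = _ := by field_simp
    have := mul_nonneg (sub_nonneg.2 hmain) hHp.le
    nlinarith
  have hh := hanti (Set.left_mem_Icc.2 h0) (Set.right_mem_Icc.2 h0) h0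
  simp only at hh
  have hqt := hq t h0
  have hbt : 0 ≤ b t := sqrt_nonneg _
  have hHt : 1 ≤ H t := one_le_exp (by
    have : 0 ≤ exp (2*t) - a^6 := by nlinarith
    positivity)
  have hGt : b t * bfun (a^3) 0 t ^ 2 ≤ G t := by
    simp only [hG]
    have : 0 ≤ (bfun (a^3) 1 t + κ t * bfun (a^3) 0 t)^2 / b t := by positivity
    linarith
  have hGt0 : 0 ≤ G t := le_trans (by positivity) hGt
  have hlog : log (a^3 - a/2) ≤ log (a^3 + a) := log_le_log (by linarith) (by linarith)
  have hm := zone_mid ha hlog le_rfl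
  set t1 := log (a^3 + a) with ht1
  have hX1 : exp (2*t1) = (a^3 + a)^2 := by rw [exp_two_mul_sq, ht1, exp_log hx]
  have hq1 : exp (2*t1) - a^6 = 2 * a^4 + a^2 := by rw [hX1]; ring
  have hb1 : a^2 ≤ b t1 := by
    simp only [hb]; rw [hq1]; exact le_sqrt_of_sq_le (by nlinarith)
  have hb1' : b t1 ≤ 2 * a^2 := by
    simp only [hb]; rw [hq1, sqrt_le_left (by positivity)]; nlinarith
  have hb1p : 0 < b t1 := by linarith
  have hH1 : H t1 ≤ exp 3 := by
    simp only [hH]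
    rw [hq1]
    apply exp_le_exp.2
    rw [div_le_iff₀ (by positivity)]
    have : a^4 * a^2 ≤ (2 * a^4 + a^2) * b t1 := mul_le_mul (by linarith [sq_nonneg a, pow_nonneg (sq_nonneg a) 2, pow_mul a 2 2]) hb1 (sq_nonneg a) (by positivity)
    linarith [show a^4 * a^2 = a^6 by ring]
  have hκ1 : κ t1 ≤ a^2 := by
    simp only [hκ]
    rw [hq1, hX1, div_le_iff₀ (by positivity)]
    nlinarith
  have hκ0 : 0 ≤ κ t1 := by
    simp only [hκ]; rw [hq1]; positivity
  have hG1 : G t1 ≤ 720 * exp 6 := by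
    simp only [hG]
    set y := bfun (a^3) 0 t1
    set z := bfun (a^3) 1 t1
    have e1 : b t1 * y^2 ≤ 360 * exp 6 := by
      have : a^2 * (a^2 * y^2) ≤ a^2 * (180 * exp 6) := by nlinarith [sq_nonneg z]
      have := le_of_mul_le_mul_left this (by positivity)
      nlinarith [mul_le_mul_of_nonneg_right hb1' (sq_nonneg y)]
    have e2 : (z + κ t1 * y)^2 / b t1 ≤ 360 * exp 6 := by
      rw [div_le_iff₀ hb1p]
      have k2 : κ t1 ^ 2 ≤ (a^2)^2 := pow_le_pow_left₀ hκ0 hκ1 2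
      have k3 := mul_le_mul_of_nonneg_right k2 (sq_nonneg y)
      have k4 : (z + κ t1 * y)^2 ≤ 2 * (z^2 + a^4 * y^2) := by
        nlinarith [sq_nonneg (z - κ t1 * y)]
      have k5 := mul_le_mul_of_nonneg_left hb1 (by positivity : 0 ≤ 360 * exp 6)
      linarith
    linarith
  calc b t * bfun (a^3) 0 t ^ 2 ≤ G t := hGt
    _ ≤ G t * H t := le_mul_of_one_le_right hGt0 hHt
    _ ≤ G t1 * H t1 := hh
    _ ≤ 720 * exp 6 * exp 3 := mul_le_mul hG1 hH1 (exp_pos _).le (by positivity)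

/-- **Decay of Bessel functions just above the turning point:** there is a constant `C`
such that `|J_ν(ν + ρ ν^{1/3})| ≤ C / (ρ^{1/4} ν^{1/3})` for all `ν ≥ 1` and
`0 < ρ ≤ (3/2) ν^{2/3}`. -/
theorem besselJ_decay_above_turning_point :
    ∃ C : ℝ, 0 < C ∧ ∀ ν ρ : ℝ, 1 ≤ ν → 0 < ρ → ρ ≤ 3 / 2 * ν ^ ((2 : ℝ) / 3) →
      |besselJ ν (ν + ρ * ν ^ ((1 : ℝ) / 3))| ≤ C / (ρ ^ ((1 : ℝ) / 4) * ν ^ ((1 : ℝ) / 3)) := by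
  refine ⟨sqrt (720 * exp 6 * exp 3), by positivity, ?_⟩
  intro ν ρ hν hρ hρ'
  have hν0 : 0 ≤ ν := by linarith
  have e3 : ν = (ν ^ ((1 : ℝ) / 3)) ^ 3 := by
    rw [← rpow_natCast, ← rpow_mul hν0]; norm_num
  have e2 : ν ^ ((2 : ℝ) / 3) = (ν ^ ((1 : ℝ) / 3)) ^ 2 := by
    rw [← rpow_natCast, ← rpow_mul hν0]; norm_num
  have ha : 1 ≤ ν ^ ((1 : ℝ) / 3) := one_le_rpow hν (by norm_num)
  rw [e2] at hρ'
  generalize ν ^ ((1 : ℝ) / 3) = a at *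
  subst e3
  have ha0 : 0 < a := by linarith
  have hxp : 0 < a^3 + ρ * a := by positivity
  rw [bessel_eq hxp]
  set t := log (a^3 + ρ * a) with ht
  have het : exp t = a^3 + ρ * a := exp_log hxp
  set y := bfun (a^3) 0 t
  set c := ρ ^ ((1 : ℝ) / 4) with hc
  have hc0 : 0 < c := rpow_pos_of_pos hρ _
  have hc2 : c^2 = sqrt ρ := by
    rw [hc, ← rpow_natCast, ← rpow_mul hρ.le, sqrt_eq_rpow]; norm_num
  rw [le_div_iff₀ (by positivity)]
  apply le_sqrt_of_sq_le
  have e : (|y| * (c * a))^2 = sqrt ρ * a^2 * y^2 := by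
    rw [mul_pow, mul_pow, sq_abs, hc2]; ring
  rw [e]
  have ha2 : 1 ≤ a^2 := one_le_pow₀ ha
  have ha3 : a ≤ a^3 := by nlinarith
  rcases le_total ρ 1 with h | h
  · have hm := zone_mid (t := t) ha (log_le_log (by linarith) (by nlinarith))
      (log_le_log hxp (by nlinarith))
    have h1 : a^2 * (a^2 * y^2) ≤ a^2 * (180 * exp 6) := by nlinarith [sq_nonneg (bfun (a^3) 1 t)]
    have h2 := le_of_mul_le_mul_left h1 (by positivity)
    have h3 : sqrt ρ ≤ 1 := by rw [sqrt_le_left (by norm_num)]; linarith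
    have h4 : 1 ≤ exp (3:ℝ) := one_le_exp (by norm_num)
    have h5 : 0 < exp (6:ℝ) := exp_pos _
    calc sqrt ρ * a^2 * y^2 = sqrt ρ * (a^2 * y^2) := by ring
      _ ≤ 1 * (a^2 * y^2) := by gcongr
      _ ≤ _ := by nlinarith
  · have ho := zone_osc (t := t) ha (log_le_log (by positivity) (by nlinarith)) (by
      rw [het]; nlinarith)
    refine le_trans ?_ ho
    gcongr
    rw [exp_two_mul_sq, het]
    apply le_sqrt_of_sq_le
    rw [mul_pow, sq_sqrt hρ.le]
    nlinarith [mul_pos hρ (pow_pos ha0 4), sq_nonneg (ρ * a)]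
end
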